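/- Let u ≥ 2 and let S be a random variable following the standard semicircle law S(0,1), with density √(4−x²)/(2π) on (−2,2). Then for every real r ≤ −1, the law of (S+u)^r (the pushforward of the law of S+u, i.e., the semicircle law S(u,1) with density √(4−(x−u)²)/(2π) on (u−2,u+2), under x ↦ x^r) belongs to the class UI. -/

import Mathlib

open MeasureTheory Set

/-- The Cauchy transform of a measure on `ℝ`, `G_μ(z) = ∫ (z-x)⁻¹ dμ(x)`. -/
noncomputable def cauchyTransform (μ : Measure ℝ) (z : ℂ) : ℂ :=
  ∫ x : ℝ, (z - (x : ℂ))⁻¹ ∂μ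

/-- The class UI: the right inverse of the Cauchy transform, defined on some triangular
domain `Λ_{γ,δ} = {w ∈ ℂ⁻ : γ|Re w| < -Im w, Im w > -δ}`, has a univalent (injective)
analytic continuation `F` to the whole lower half-plane. -/
def IsUI (μ : Measure ℝ) : Prop :=
  ∃ F : ℂ → ℂ,
    AnalyticOnNhd ℂ F {z : ℂ | z.im < 0} ∧
    Set.InjOn F {z : ℂ | z.im < 0} ∧
    ∃ γ : ℝ, 0 < γ ∧ ∃ δ : ℝ, 0 < δ ∧
      ∀ w : ℂ, γ * |w.re| < -w.im → -δ < w.im →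
        0 < (F w).im ∧ cauchyTransform μ (F w) = w

/-- The semicircle distribution `S(m,1)`: the probability measure with density
`√(4-(x-m)²)/(2π)` on `(m-2, m+2)`. -/
noncomputable def semicircle (m : ℝ) : Measure ℝ :=
  MeasureTheory.volume.withDensity
    (fun x => ENNReal.ofReal
      ((Set.Ioo (m - 2) (m + 2)).indicator
        (fun x => Real.sqrt (4 - (x - m) ^ 2) / (2 * Real.pi)) x))

open Filter Topology

/-- Near a critical point, a non-constant holomorphic function takes each nearby value
at least twice. -/
lemma AnalyticAt.eventually_two_preimages {f : ℂ → ℂ} {z₀ : ℂ} (hf : AnalyticAt ℂ f z₀)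
    (hnc : ¬ ∀ᶠ z in 𝓝 z₀, f z = f z₀) (hd : deriv f z₀ = 0) {N : Set ℂ} (hN : N ∈ 𝓝 z₀) :
    ∀ᶠ w in 𝓝[≠] (f z₀), ∃ a ∈ N, ∃ b ∈ N, a ≠ b ∧ f a = w ∧ f b = w := by
  have hf' : AnalyticAt ℂ (fun z => f z - f z₀) z₀ := hf.sub analyticAt_const
  obtain ⟨n, g, hg, hg0, hfg⟩ := hf'.exists_eventuallyEq_pow_smul_nonzero_iff.2
    (by simpa [sub_eq_zero] using hnc)
  have hn0 : n ≠ 0 := by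
    rintro rfl
    have := hfg.self_of_nhds
    simp at this
    exact hg0 this.symm
  have hn1 : n ≠ 1 := by
    rintro rfl
    have h1 : HasDerivAt (fun z => (z - z₀) ^ 1 • g z) (g z₀) z₀ := by
      have := ((hasDerivAt_id z₀).sub_const z₀).fun_mul hg.differentiableAt.hasDerivAt
      simpa using this
    have h2 := (h1.congr_of_eventuallyEq hfg).deriv
    rw [deriv_sub_const, hd] at h2
    exact hg0 h2.symm
  have hn : 2 ≤ n := by omega
  set φ : ℂ → ℂ := fun z => (z - z₀) * (g z / g z₀) ^ ((1 : ℂ) / n) with hφ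
  have hroot : AnalyticAt ℂ (fun z => (g z / g z₀) ^ ((1 : ℂ) / n)) z₀ := by
    refine AnalyticAt.cpow (hg.div analyticAt_const hg0) analyticAt_const ?_
    simp [hg0]
  have hφa : AnalyticAt ℂ φ z₀ := (analyticAt_id.sub analyticAt_const).mul hroot
  have hφd : HasDerivAt φ 1 z₀ := by
    have := ((hasDerivAt_id z₀).sub_const z₀).fun_mul hroot.differentiableAt.hasDerivAt
    simpa [hg0, hφ] using this
  have hφs : HasStrictDerivAt φ 1 z₀ := by
    have := hφa.hasStrictDerivAt
    rwa [hφd.deriv] at this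
  have hpow : ∀ᶠ z in 𝓝 z₀, f z = f z₀ + g z₀ * φ z ^ n := by
    filter_upwards [hfg] with z hz
    have h1 : ((g z / g z₀) ^ ((1 : ℂ) / n)) ^ n = g z / g z₀ := by
      rw [one_div, Complex.cpow_nat_inv_pow _ hn0]
    rw [hφ]
    simp only [mul_pow, h1]
    have : f z = f z₀ + (f z - f z₀) := by ring
    rw [this, hz, smul_eq_mul]
    field_simp
  have hmap : map φ (𝓝 z₀) = 𝓝 0 := by
    have := hφs.map_nhds_eq one_ne_zero
    simpa [hφ] using this
  have himg : φ '' (N ∩ {z | f z = f z₀ + g z₀ * φ z ^ n}) ∈ 𝓝 (0 : ℂ) := by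
    rw [← hmap]
    exact image_mem_map (inter_mem hN hpow)
  obtain ⟨r, hr, hball⟩ := Metric.mem_nhds_iff.1 himg
  have hgn : 0 < ‖g z₀‖ := norm_pos_iff.2 hg0
  have hev : ∀ᶠ w in 𝓝 (f z₀), ‖w - f z₀‖ < ‖g z₀‖ * r ^ n := by
    have : 0 < ‖g z₀‖ * r ^ n := by positivity
    filter_upwards [Metric.ball_mem_nhds (f z₀) this] with w hw
    rwa [Metric.mem_ball, dist_eq_norm] at hw
  rw [eventually_nhdsWithin_iff]
  filter_upwards [hev] with w hw hne
  set ξ : ℂ := ((w - f z₀) / g z₀) ^ ((1 : ℂ) / n) with hξ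
  have hξn : ξ ^ n = (w - f z₀) / g z₀ := by
    rw [hξ, one_div, Complex.cpow_nat_inv_pow _ hn0]
  have hξ0 : ξ ≠ 0 := by
    intro h
    rw [h, zero_pow hn0] at hξn
    exact hne (sub_eq_zero.1 ((div_eq_zero_iff.1 hξn.symm).resolve_right hg0))
  have hξr : ‖ξ‖ < r := by
    have h1 : ‖ξ‖ ^ n < r ^ n := by
      rw [← norm_pow, hξn, norm_div, div_lt_iff₀ hgn]
      linarith
    exact lt_of_pow_lt_pow_left₀ n hr.le h1
  have hω := Complex.isPrimitiveRoot_exp n hn0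
  set ω := Complex.exp (2 * Real.pi * Complex.I / n)
  have hωn : ‖ω‖ = 1 := hω.norm'_eq_one hn0
  obtain ⟨a, ⟨haN, ha⟩, haξ⟩ := hball (show ξ ∈ Metric.ball 0 r by simpa using hξr)
  obtain ⟨b, ⟨hbN, hb⟩, hbξ⟩ := hball (show ω * ξ ∈ Metric.ball 0 r by simpa [hωn] using hξr)
  refine ⟨a, haN, b, hbN, ?_, ?_, ?_⟩
  · rintro rfl
    rw [haξ] at hbξ
    have : ω = 1 := by
      have := mul_right_cancel₀ hξ0 (show 1 * ξ = ω * ξ by rw [one_mul]; exact hbξ)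
      exact this.symm
    exact hω.ne_one (by omega) this
  · rw [ha, haξ, hξn]; field_simp; ring
  · rw [hb, hbξ, mul_pow, hω.pow_eq_one, one_mul, hξn]; field_simp; ring

/-- A proper holomorphic map of an open set `U` to a connected open set `V` which is injective over
a nonempty open subset of `V` is a bijection with nonvanishing derivative. -/
lemma bijOn_of_proper_of_injOn_fiber {U V W : Set ℂ} {f : ℂ → ℂ} (hU : IsOpen U)
    (hVc : IsPreconnected V) (hf : DifferentiableOn ℂ f U) (hmaps : MapsTo f U V)
    (hne : U.Nonempty)
    (hprop : ∀ 𝒰 : Ultrafilter ℂ, U ∈ 𝒰 → ∀ w ∈ V, Tendsto f 𝒰 (𝓝 w) → ∃ s ∈ U, (𝒰 : Filter ℂ) ≤ 𝓝 s)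
    (hWo : IsOpen W) (hWne : W.Nonempty) (hWV : W ⊆ V)
    (hW : ∀ a ∈ U, ∀ b ∈ U, f a ∈ W → f a = f b → a = b) :
    BijOn f U V ∧ ∀ z ∈ U, deriv f z ≠ 0 := by
  have han : ∀ z ∈ U, AnalyticAt ℂ f z := fun z hz => hf.analyticAt (hU.mem_nhds hz)
  have hnc : ∀ z ∈ U, ¬ ∀ᶠ z' in 𝓝 z, f z' = f z := by
    intro z₀ hz₀ hconst
    set S : Set ℂ := {z | z ∈ U ∧ ∀ᶠ z' in 𝓝 z, f z' = f z₀} with hS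
    have hSo : IsOpen S := by
      rw [isOpen_iff_mem_nhds]
      rintro z ⟨hz, hz'⟩
      filter_upwards [hU.mem_nhds hz, hz'.eventually_nhds] with y hy hy'
      exact ⟨hy, hy'⟩
    have hSc : IsCompact S := by
      rw [isCompact_iff_ultrafilter_le_nhds]
      intro 𝒰 h𝒰
      have hS𝒰 : S ∈ 𝒰 := le_principal_iff.1 h𝒰
      have hlim : Tendsto f 𝒰 (𝓝 (f z₀)) := by
        refine tendsto_nhds_of_eventually_eq ?_
        filter_upwards [hS𝒰] with y hy using hy.2.self_of_nhds
      obtain ⟨s, hsU, hs⟩ := hprop 𝒰 (mem_of_superset hS𝒰 fun y hy => hy.1) _ (hmaps hz₀) hlim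
      refine ⟨s, ⟨hsU, ?_⟩, hs⟩
      rcases ((han s hsU).sub (analyticAt_const (v := f z₀))).eventually_eq_zero_or_eventually_ne_zero
        with h | h
      · simpa [sub_eq_zero] using h
      · exfalso
        rw [eventually_nhdsWithin_iff] at h
        have h1 := hs h
        have h2 : ∀ᶠ y in (𝒰 : Filter ℂ), y = s := by
          filter_upwards [h1, hS𝒰] with y hy hy'
          by_contra hne'
          exact hy hne' (by simp [hy'.2.self_of_nhds])
        obtain ⟨y, hy, hy'⟩ := (h2.and hS𝒰).exists
        subst hy
        have h3 : ∀ᶠ x in 𝓝[≠] y, f x = f z₀ := hy'.2.filter_mono nhdsWithin_le_nhds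
        have h4 : ∀ᶠ x in 𝓝[≠] y, x ≠ y := eventually_mem_nhdsWithin
        obtain ⟨x, hx, hx', hx''⟩ := (h3.and ((eventually_nhdsWithin_iff.2 h).and h4)).exists
        exact hx' (by simp [hx])
    have huniv : S = univ := IsClopen.eq_univ ⟨hSc.isClosed, hSo⟩ ⟨z₀, hz₀, hconst⟩
    rw [huniv] at hSc
    exact noncompact_univ ℂ hSc
  have hopen : ∀ z ∈ U, 𝓝 (f z) ≤ map f (𝓝 z) := fun z hz =>
    (han z hz).eventually_constant_or_nhds_le_map_nhds.resolve_left (hnc z hz)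
  have hcl : ∀ w ∈ V, w ∈ closure (f '' U) → w ∈ f '' U := by
    intro w hw hcw
    have hne' : (comap f (𝓝 w) ⊓ 𝓟 U).NeBot := by
      rw [mem_closure_iff_comap_neBot] at hcw
      rw [← mem_closure_iff_comap_neBot] at hcw
      rw [mem_closure_iff_nhds] at hcw
      rw [inf_principal_neBot_iff]
      rintro A ⟨B, hB, hBA⟩
      obtain ⟨_, hy, x, hx, rfl⟩ := hcw B hB
      exact ⟨x, hBA hy, hx⟩
    obtain ⟨𝒰, h𝒰⟩ := @Ultrafilter.exists_le _ _ hne'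
    have hU𝒰 : U ∈ 𝒰 := le_principal_iff.1 (h𝒰.trans inf_le_right)
    have ht : Tendsto f 𝒰 (𝓝 w) := tendsto_iff_comap.2 (h𝒰.trans inf_le_left)
    obtain ⟨s, hs, hs'⟩ := hprop 𝒰 hU𝒰 w hw ht
    refine ⟨s, hs, ?_⟩
    exact tendsto_nhds_unique (((han s hs).continuousAt.tendsto).mono_left hs') ht
  have hfUo : IsOpen (f '' U) := by
    rw [isOpen_iff_mem_nhds]
    rintro _ ⟨z, hz, rfl⟩
    exact hopen z hz (image_mem_map (hU.mem_nhds hz))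
  have hsurj : V ⊆ f '' U := hVc.subset_of_closure_inter_subset hfUo
    (by obtain ⟨z, hz⟩ := hne; exact ⟨f z, hmaps hz, z, hz, rfl⟩) (fun w hw => hcl w hw.2 hw.1)
  set A : Set ℂ := {w | ∀ a ∈ U, ∀ b ∈ U, f a = w → f b = w → a = b} with hA
  have hVA : V ⊆ interior A := by
    refine hVc.subset_of_closure_inter_subset isOpen_interior ?_ ?_
    · obtain ⟨w, hw⟩ := hWne
      refine ⟨w, hWV hw, interior_mono (s := W) ?_ (by rwa [hWo.interior_eq])⟩
      intro w' hw' a ha b hb hfa hfb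
      exact hW a ha b hb (hfa ▸ hw') (hfa.trans hfb.symm)
    · rintro w ⟨hwc, hwV⟩
      obtain ⟨z₀, hz₀, rfl⟩ := hsurj hwV
      have huniq : ∀ z ∈ U, f z = f z₀ → z = z₀ := by
        intro z hz hzz
        by_contra hne'
        obtain ⟨N₁, N₂, hN₁, hN₂, hdisj⟩ := t2_separation_nhds hne'
        have h1 : f '' (N₁ ∩ U) ∈ 𝓝 (f z₀) := by
          rw [← hzz]
          exact hopen z hz (image_mem_map (inter_mem hN₁ (hU.mem_nhds hz)))
        have h2 : f '' (N₂ ∩ U) ∈ 𝓝 (f z₀) :=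
          hopen z₀ hz₀ (image_mem_map (inter_mem hN₂ (hU.mem_nhds hz₀)))
        obtain ⟨_, ⟨⟨a, ha, rfl⟩, b, hb, hab⟩, hw⟩ :=
          mem_closure_iff_nhds.1 hwc _ (inter_mem h1 h2)
        have := interior_subset hw a ha.2 b hb.2 rfl hab
        exact hdisj.ne_of_mem ha.1 hb.1 this
      by_cases hd : deriv f z₀ = 0
      · by_contra hnA
        have h2 := (han z₀ hz₀).eventually_two_preimages (hnc z₀ hz₀) hd (hU.mem_nhds hz₀)
        rw [eventually_nhdsWithin_iff] at h2
        obtain ⟨w, hw, hwA⟩ := mem_closure_iff_nhds.1 hwc _ h2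
        obtain ⟨a, ha, b, hb, hab, hfa, hfb⟩ := hw (by
          rintro rfl
          exact hnA hwA)
        exact hab (interior_subset hwA a ha b hb hfa hfb)
      · have hst := (han z₀ hz₀).hasStrictDerivAt
        obtain ⟨N, hN, hinj⟩ : ∃ N ∈ 𝓝 z₀, InjOn f N := by
          refine ⟨_, (hst.hasStrictFDerivAt_equiv hd).toOpenPartialHomeomorph f
            |>.open_source.mem_nhds ?_, OpenPartialHomeomorph.injOn _⟩
          exact (hst.hasStrictFDerivAt_equiv hd).mem_toOpenPartialHomeomorph_source
        have hloc : ∀ᶠ w in 𝓝 (f z₀), ∀ s ∈ U, f s = w → s ∈ N := by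
          by_contra hcon
          have hne' : (comap f (𝓝 (f z₀)) ⊓ 𝓟 (U \ N)).NeBot := by
            rw [inf_principal_neBot_iff]
            rintro A ⟨B, hB, hBA⟩
            have hfr : ∃ᶠ w in 𝓝 (f z₀), ¬ ∀ s ∈ U, f s = w → s ∈ N :=
              not_eventually.1 hcon
            obtain ⟨w, hw, hwB⟩ := (hfr.and_eventually hB).exists
            push Not at hw
            obtain ⟨s, hs, rfl, hsN⟩ := hw
            exact ⟨s, hBA hwB, hs, hsN⟩
          obtain ⟨𝒰, h𝒰⟩ := @Ultrafilter.exists_le _ _ hne'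
          have hU𝒰 : U \ N ∈ 𝒰 := le_principal_iff.1 (h𝒰.trans inf_le_right)
          have ht : Tendsto f 𝒰 (𝓝 (f z₀)) := tendsto_iff_comap.2 (h𝒰.trans inf_le_left)
          obtain ⟨s, hs, hs'⟩ := hprop 𝒰 (mem_of_superset hU𝒰 sdiff_subset) _ hwV ht
          have hfs : f s = f z₀ :=
            tendsto_nhds_unique (((han s hs).continuousAt.tendsto).mono_left hs') ht
          have := huniq s hs hfs
          subst this
          obtain ⟨y, hy, hy'⟩ := (Filter.inter_mem hU𝒰 (hs' hN) |> 𝒰.nonempty_of_mem)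
          exact hy.2 hy'
        rw [mem_interior_iff_mem_nhds]
        filter_upwards [hloc] with w hw a ha b hb hfa hfb
        exact hinj (hw a ha hfa) (hw b hb hfb) (hfa.trans hfb.symm)
  have hinj : InjOn f U := fun a ha b hb hab => interior_subset (hVA (hmaps ha)) a ha b hb rfl hab.symm
  refine ⟨⟨hmaps, hinj, hsurj⟩, fun z hz hd => ?_⟩
  have h2 := (han z hz).eventually_two_preimages (hnc z hz) hd (hU.mem_nhds hz)
  obtain ⟨w, a, ha, b, hb, hab, hfa, hfb⟩ := h2.exists
  exact hab (hinj ha hb (hfa.trans hfb.symm))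

/-- Trigonometric parametrisation of the semicircle law. -/
lemma integral_semicircle_eq (u : ℝ) {f : ℝ → ℂ} (hf : ContinuousOn f (Icc (u - 2) (u + 2))) :
    ∫ t, f t ∂(semicircle u) =
      (2 / Real.pi : ℂ) * ∫ θ in (0 : ℝ)..Real.pi, (Real.sin θ : ℂ) ^ 2 * f (u - 2 * Real.cos θ) := by
  have hpi := Real.pi_pos
  have hmeas : Measurable (fun x : ℝ => (Ioo (u - 2) (u + 2)).indicator
        (fun x => Real.sqrt (4 - (x - u) ^ 2) / (2 * Real.pi)) x) := by
    refine Measurable.indicator ?_ measurableSet_Ioo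
    fun_prop
  rw [semicircle, integral_withDensity_eq_integral_toReal_smul hmeas.ennreal_ofReal
    (by simp)]
  have h1 : ∀ x : ℝ, (ENNReal.ofReal ((Ioo (u - 2) (u + 2)).indicator
        (fun x => Real.sqrt (4 - (x - u) ^ 2) / (2 * Real.pi)) x)).toReal • f x =
      (Ioo (u - 2) (u + 2)).indicator
        (fun x => (Real.sqrt (4 - (x - u) ^ 2) / (2 * Real.pi)) • f x) x := by
    intro x
    by_cases hx : x ∈ Ioo (u - 2) (u + 2)
    · simp only [indicator_of_mem hx]
      rw [ENNReal.toReal_ofReal (by positivity)]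
    · simp [indicator_of_notMem hx]
  simp_rw [h1]
  rw [integral_indicator measurableSet_Ioo, ← integral_Ioc_eq_integral_Ioo,
    ← intervalIntegral.integral_of_le (by linarith)]
  set φ : ℝ → ℝ := fun θ => u - 2 * Real.cos θ with hφ
  have hφ0 : φ 0 = u - 2 := by simp [hφ]
  have hφp : φ Real.pi = u + 2 := by simp [hφ]
  have himg : φ '' (uIcc 0 Real.pi) ⊆ Icc (u - 2) (u + 2) := by
    rintro _ ⟨θ, -, rfl⟩
    have := Real.cos_le_one θ
    have := Real.neg_one_le_cos θ
    constructor <;> simp only [hφ] <;> linarith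
  have key := intervalIntegral.integral_deriv_smul_comp'' (a := 0) (b := Real.pi) (f := φ)
    (f' := fun θ => 2 * Real.sin θ)
    (g := fun x => (Real.sqrt (4 - (x - u) ^ 2) / (2 * Real.pi)) • f x)
    (by fun_prop)
    (fun x _ => by
      have : HasDerivAt φ (2 * Real.sin x) x := by
        have := ((Real.hasDerivAt_cos x).const_mul 2).const_sub u
        simpa [hφ] using this
      exact this.hasDerivWithinAt)
    (by fun_prop)
    (ContinuousOn.smul (Continuous.continuousOn
      (f := fun x : ℝ => Real.sqrt (4 - (x - u) ^ 2) / (2 * Real.pi)) (by fun_prop))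
      (hf.mono himg))
  rw [hφ0, hφp] at key
  rw [← key, ← intervalIntegral.integral_const_mul]
  refine intervalIntegral.integral_congr fun θ hθ => ?_
  rw [uIcc_of_le hpi.le] at hθ
  have hs : 0 ≤ Real.sin θ := Real.sin_nonneg_of_mem_Icc hθ
  have hsq : Real.sqrt (4 - (φ θ - u) ^ 2) = 2 * Real.sin θ := by
    rw [show 4 - (φ θ - u) ^ 2 = (2 * Real.sin θ) ^ 2 by
      simp only [hφ]; nlinarith [Real.sin_sq_add_cos_sq θ]]
    exact Real.sqrt_sq (by positivity)
  simp only [Function.comp_apply, hsq, Complex.real_smul]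
  have : (Real.pi : ℂ) ≠ 0 := by exact_mod_cast hpi.ne'
  simp only [hφ]
  push_cast
  field_simp

lemma semicircle_real_univ (u : ℝ) : (semicircle u).real univ = 1 := by
  have h := integral_semicircle_eq u (f := fun _ => 1) continuousOn_const
  simp only [integral_const, mul_one] at h
  have h2 : ∫ θ in (0 : ℝ)..Real.pi, (Real.sin θ : ℂ) ^ 2 = ((Real.pi / 2 : ℝ) : ℂ) := by
    have : ∫ θ in (0 : ℝ)..Real.pi, (Real.sin θ) ^ 2 = Real.pi / 2 := by
      rw [integral_sin_sq]; simp
    rw [← this, ← intervalIntegral.integral_ofReal]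
    simp
  rw [h2] at h
  have hpi : (Real.pi : ℂ) ≠ 0 := by exact_mod_cast Real.pi_pos.ne'
  push_cast at h
  rw [show (2 / Real.pi : ℂ) * (Real.pi / 2) = 1 by field_simp] at h
  simpa using congrArg Complex.re h

instance semicircle_isProbabilityMeasure (u : ℝ) : IsProbabilityMeasure (semicircle u) := by
  constructor
  have := semicircle_real_univ u
  rwa [Measure.real, ENNReal.toReal_eq_one_iff] at this

lemma semicircle_absolutelyContinuous (u : ℝ) : semicircle u ≪ volume :=
  withDensity_absolutelyContinuous _ _

lemma ae_mem_Ioo_semicircle (u : ℝ) : ∀ᵐ t ∂(semicircle u), t ∈ Ioo (u - 2) (u + 2) := by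
  rw [ae_iff, semicircle]
  change volume.withDensity _ (Ioo (u - 2) (u + 2))ᶜ = 0
  rw [withDensity_apply _ measurableSet_Ioo.compl]
  refine (setLIntegral_congr_fun measurableSet_Ioo.compl (g := fun _ => 0) ?_).trans (by simp)
  intro x hx
  simp [indicator_of_notMem hx]

lemma integral_div_add_exp {s : ℂ} (hs : 1 < ‖s‖) :
    ∫ θ in (0 : ℝ)..Real.pi, (s / (s + Complex.exp (θ * Complex.I)) +
      s / (s + Complex.exp (-(θ * Complex.I)))) = 2 * Real.pi := by
  have hs0 : s ≠ 0 := by rintro rfl; simp at hs; linarith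
  have hne : ∀ z : ℂ, ‖z‖ ≤ 1 → s + z ≠ 0 := by
    intro z hz h
    have : ‖s‖ = ‖z‖ := by rw [eq_neg_of_add_eq_zero_left h, norm_neg]
    linarith
  set g : ℝ → ℂ := fun θ => s / (s + Complex.exp (θ * Complex.I)) with hg
  have hgc : Continuous g := by
    refine Continuous.div continuous_const (by fun_prop) fun θ => hne _ ?_
    rw [Complex.norm_exp_ofReal_mul_I]
  have hper : Function.Periodic g (2 * Real.pi) := by
    intro θ
    simp only [hg]
    push_cast
    rw [show ((θ : ℂ) + 2 * Real.pi) * Complex.I = θ * Complex.I + 2 * Real.pi * Complex.I by ring,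
      Complex.exp_periodic]
  have havg : ∫ θ in (0 : ℝ)..2 * Real.pi, g θ = 2 * Real.pi := by
    have h := circleAverage_of_differentiable_on_off_countable (f := fun z : ℂ => s / (s + z))
      (c := 0) (R := 1) countable_empty
      (by
        refine ContinuousOn.div continuousOn_const (by fun_prop) fun z hz => hne z ?_
        simpa using hz)
      (fun z hz => by
        refine DifferentiableAt.div (by fun_prop) (by fun_prop) (hne z ?_)
        have := hz.1
        simp at this
        exact this.le)
    rw [Real.circleAverage_def] at h
    simp only [circleMap_zero, Complex.ofReal_one, one_mul, add_zero, div_self hs0] at h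
    have hpi : (Real.pi : ℂ) ≠ 0 := by exact_mod_cast Real.pi_pos.ne'
    have h' := congrArg (fun x : ℂ => (2 * Real.pi : ℝ) • x) h
    simp only [smul_smul] at h'
    rw [mul_inv_cancel₀ (by positivity), one_smul] at h'
    rw [hg, h']
    simp
  have hneg : ∫ θ in (0 : ℝ)..Real.pi, s / (s + Complex.exp (-(θ * Complex.I))) =
      ∫ θ in (-Real.pi)..0, g θ := by
    have := intervalIntegral.integral_comp_neg (a := 0) (b := Real.pi) g
    rw [neg_zero] at this
    rw [← this]
    simp [hg]
  have hi : ∀ a b : ℝ, IntervalIntegrable g volume a b := fun a b => hgc.intervalIntegrable a b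
  rw [intervalIntegral.integral_add (hi 0 Real.pi), hneg, add_comm,
    intervalIntegral.integral_add_adjacent_intervals (hi _ _) (hi _ _)]
  · rw [← havg]
    have := hper.intervalIntegral_add_eq (-Real.pi) 0
    rw [zero_add] at this
    rw [← this]
    congr 1
    ring
  · have := (hgc.comp continuous_neg).intervalIntegrable (μ := volume) 0 Real.pi
    simpa [hg, Function.comp_def] using this

/-- The Joukowsky variable gives the Cauchy transform of the semicircle law. -/
lemma integral_inv_sub_semicircle (u : ℝ) {s : ℂ} (hs : 1 < ‖s‖) :
    ∫ t : ℝ, ((u + s + s⁻¹) - (t : ℂ))⁻¹ ∂(semicircle u) = s⁻¹ ∧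
      ∀ t ∈ Icc (u - 2) (u + 2), (u + s + s⁻¹) - (t : ℂ) ≠ 0 := by
  have hs0 : s ≠ 0 := by rintro rfl; simp at hs; linarith
  have hne : ∀ z : ℂ, ‖z‖ ≤ 1 → s + z ≠ 0 := by
    intro z hz h
    have : ‖s‖ = ‖z‖ := by rw [eq_neg_of_add_eq_zero_left h, norm_neg]
    linarith
  have hE : ∀ θ : ℝ, s + Complex.exp (θ * Complex.I) ≠ 0 := fun θ => hne _ (by
    rw [Complex.norm_exp_ofReal_mul_I])
  have hE' : ∀ θ : ℝ, s + Complex.exp (-(θ * Complex.I)) ≠ 0 := fun θ => hne _ (by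
    have := Complex.norm_exp_ofReal_mul_I (-θ)
    push_cast at this
    rw [neg_mul] at this
    exact this.le)
  have hEE : ∀ θ : ℝ, Complex.exp (θ * Complex.I) * Complex.exp (-(θ * Complex.I)) = 1 := fun θ => by
    rw [← Complex.exp_add]; simp
  have hcos : ∀ θ : ℝ, 2 * (Real.cos θ : ℂ) =
      Complex.exp (θ * Complex.I) + Complex.exp (-(θ * Complex.I)) := fun θ => by
    rw [Complex.ofReal_cos, Complex.two_cos, neg_mul]
  have hfac : ∀ θ : ℝ, s + s⁻¹ + 2 * (Real.cos θ : ℂ) =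
      (s + Complex.exp (θ * Complex.I)) * (s + Complex.exp (-(θ * Complex.I))) / s := fun θ => by
    rw [hcos]
    field_simp
    linear_combination - hEE θ
  have hvne : ∀ θ : ℝ, s + s⁻¹ + 2 * (Real.cos θ : ℂ) ≠ 0 := fun θ => by
    rw [hfac]
    exact div_ne_zero (mul_ne_zero (hE θ) (hE' θ)) hs0
  have hden : ∀ t ∈ Icc (u - 2) (u + 2), (u + s + s⁻¹) - (t : ℂ) ≠ 0 := by
    intro t ht
    have h1 : Real.cos (Real.arccos ((u - t) / 2)) = (u - t) / 2 :=
      Real.cos_arccos (by linarith [ht.2]) (by linarith [ht.1])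
    have := hvne (Real.arccos ((u - t) / 2))
    rw [h1] at this
    push_cast at this
    convert this using 1
    ring
  refine ⟨?_, hden⟩
  rw [integral_semicircle_eq u (by
    refine ContinuousOn.inv₀ (by fun_prop) hden)]
  have hpt : ∀ θ : ℝ, (Real.sin θ : ℂ) ^ 2 * ((u + s + s⁻¹) - ((u - 2 * Real.cos θ : ℝ) : ℂ))⁻¹ =
      (1 / 4) * ((s + s⁻¹ + (s - s⁻¹)) - 2 * (Real.cos θ : ℂ) - (s - s⁻¹) *
        (s / (s + Complex.exp (θ * Complex.I)) + s / (s + Complex.exp (-(θ * Complex.I))))) := by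
    intro θ
    have h1 : (u + s + s⁻¹) - ((u - 2 * Real.cos θ : ℝ) : ℂ) = s + s⁻¹ + 2 * (Real.cos θ : ℂ) := by
      push_cast; ring
    have hsin : (Real.sin θ : ℂ) ^ 2 = 1 - (Real.cos θ : ℂ) ^ 2 := by
      have : Real.sin θ ^ 2 = 1 - Real.cos θ ^ 2 := by linarith [Real.sin_sq_add_cos_sq θ]
      exact_mod_cast this
    have hc : (Real.cos θ : ℂ) = (Complex.exp (θ * Complex.I) + Complex.exp (-(θ * Complex.I))) / 2 := by
      rw [← hcos]; ring
    rw [h1, hfac, hsin, hc]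
    have e1 := hE θ
    have e2 := hE' θ
    have e3 := hEE θ
    generalize Complex.exp (θ * Complex.I) = a at *
    generalize Complex.exp (-(θ * Complex.I)) = b at *
    have h2 : s / (s + a) + s / (s + b) = s * (2 * s + (a + b)) / ((s + a) * (s + b)) := by
      rw [div_add_div _ _ e1 e2]
      ring
    have hP : (s + a) * (s + b) ≠ 0 := mul_ne_zero e1 e2
    have hP' : (s + a) * (s + b) = s ^ 2 + s * (a + b) + 1 := by linear_combination e3
    rw [h2]
    rw [hP'] at hP ⊢
    generalize a + b = c at *
    rw [inv_div]
    have hP2 : s * (s + c) + 1 ≠ 0 := by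
      convert hP using 1
      ring
    field_simp
    ring
  have hcont : Continuous fun θ : ℝ =>
      (s / (s + Complex.exp (θ * Complex.I)) + s / (s + Complex.exp (-(θ * Complex.I)))) :=
    (Continuous.div continuous_const (by fun_prop) hE).add
      (Continuous.div continuous_const (by fun_prop) hE')
  have hcosint : ∫ θ in (0 : ℝ)..Real.pi, (2 * (Real.cos θ : ℂ)) = 0 := by
    rw [intervalIntegral.integral_const_mul, intervalIntegral.integral_ofReal, integral_cos]
    simp
  simp_rw [hpt]
  rw [intervalIntegral.integral_const_mul, intervalIntegral.integral_sub, intervalIntegral.integral_sub,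
    hcosint, intervalIntegral.integral_const_mul, integral_div_add_exp hs,
    intervalIntegral.integral_const]
  · have hpi : (Real.pi : ℂ) ≠ 0 := by exact_mod_cast Real.pi_pos.ne'
    simp only [Complex.real_smul]
    push_cast
    field_simp
    ring
  · exact continuous_const.intervalIntegrable _ _
  · exact Continuous.intervalIntegrable (by fun_prop) _ _
  · exact Continuous.intervalIntegrable (by fun_prop) _ _
  · exact Continuous.intervalIntegrable (by fun_prop) _ _

lemma dslope_exp_zero_mul (x : ℂ) : x * dslope Complex.exp 0 x = Complex.exp x - 1 := by
  have := sub_smul_dslope Complex.exp 0 x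
  simpa using this

lemma dslope_exp_zero_ne_zero {x : ℂ} (hx : |x.im| < 2 * Real.pi) :
    dslope Complex.exp 0 x ≠ 0 := by
  intro h
  have h1 := dslope_exp_zero_mul x
  rw [h, mul_zero, eq_comm, sub_eq_zero, Complex.exp_eq_one_iff] at h1
  obtain ⟨n, rfl⟩ := h1
  have hn : n = 0 := by
    by_contra hn
    have h2 : (1 : ℝ) ≤ |(n : ℝ)| := by exact_mod_cast Int.one_le_abs hn
    have h3 : ((n : ℂ) * (2 * Real.pi * Complex.I)).im = n * (2 * Real.pi) := by simp
    rw [h3, abs_mul, abs_of_pos Real.two_pi_pos] at hx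
    nlinarith [Real.two_pi_pos]
  simp [hn] at h

lemma differentiable_dslope_exp_zero : Differentiable ℂ (dslope Complex.exp 0) := by
  rw [← differentiableOn_univ, Complex.differentiableOn_dslope univ_mem]
  exact Complex.differentiable_exp.differentiableOn

/-- The kernel `(1 - e^{qℓ})⁻¹ - q⁻¹ e^ℓ / (1 - e^ℓ)`, extended holomorphically through `0`. -/
noncomputable def powKernel (q : ℝ) : ℂ → ℂ := fun ℓ => (q : ℂ)⁻¹ *
  dslope (fun ℓ => Complex.exp ℓ / dslope Complex.exp 0 ℓ - 1 / dslope Complex.exp 0 (q * ℓ)) 0 ℓ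

lemma powKernel_of_ne {q : ℝ} (hq : 1 ≤ q) {ℓ : ℂ} (h : ℓ ≠ 0) :
    powKernel q ℓ = (1 - Complex.exp (q * ℓ))⁻¹ - (q : ℂ)⁻¹ * ((1 - Complex.exp ℓ)⁻¹ * Complex.exp ℓ) := by
  have hq0 : (q : ℂ) ≠ 0 := by exact_mod_cast (by linarith : q ≠ 0)
  have e1 : dslope Complex.exp 0 ℓ = (Complex.exp ℓ - 1) / ℓ := by
    rw [← dslope_exp_zero_mul]; field_simp
  have e2 : dslope Complex.exp 0 (q * ℓ) = (Complex.exp (q * ℓ) - 1) / (q * ℓ) := by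
    rw [← dslope_exp_zero_mul]; field_simp
  rw [powKernel, dslope_of_ne _ h, slope_def_field, e1, e2]
  simp only [mul_zero, dslope_same, Complex.deriv_exp, Complex.exp_zero, div_one, sub_self, sub_zero]
  rw [← neg_sub (Complex.exp ℓ), ← neg_sub (Complex.exp (q * ℓ)), inv_neg, inv_neg]
  simp only [div_eq_mul_inv, mul_inv, inv_inv]
  generalize (Complex.exp (q * ℓ) - 1)⁻¹ = a
  generalize (Complex.exp (ℓ) - 1)⁻¹ = b
  field_simp
  ring

lemma measurable_powKernel {q : ℝ} (hq : 1 ≤ q) : Measurable (powKernel q) := by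
  classical
  have : powKernel q = fun ℓ => if ℓ = 0 then powKernel q 0 else
      (1 - Complex.exp (q * ℓ))⁻¹ - (q : ℂ)⁻¹ * ((1 - Complex.exp ℓ)⁻¹ * Complex.exp ℓ) := by
    ext ℓ
    split_ifs with h
    · rw [h]
    · exact powKernel_of_ne hq h
  rw [this]
  refine Measurable.ite (measurableSet_singleton 0) measurable_const ?_
  fun_prop

lemma differentiableOn_powKernel {q : ℝ} (hq : 1 ≤ q) :
    DifferentiableOn ℂ (powKernel q) {ℓ | |ℓ.im| < 2 * (Real.pi / q)} := by
  have hq0 : 0 < q := by linarith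
  have hpi := Real.pi_pos
  have ho : IsOpen {ℓ : ℂ | |ℓ.im| < 2 * (Real.pi / q)} :=
    isOpen_lt (by fun_prop) (by fun_prop)
  refine DifferentiableOn.const_mul ?_ _
  rw [Complex.differentiableOn_dslope (ho.mem_nhds (by simp; positivity))]
  refine DifferentiableOn.sub (DifferentiableOn.div (by fun_prop)
    differentiable_dslope_exp_zero.differentiableOn fun ℓ hℓ => dslope_exp_zero_ne_zero ?_)
    (DifferentiableOn.div (by fun_prop) (differentiable_dslope_exp_zero.comp
      (by fun_prop : Differentiable ℂ fun ℓ : ℂ => (q : ℂ) * ℓ)).differentiableOn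
      fun ℓ hℓ => dslope_exp_zero_ne_zero ?_)
  · have : Real.pi / q ≤ Real.pi := div_le_self hpi.le hq
    have h2 : |ℓ.im| < 2 * (Real.pi / q) := hℓ
    linarith
  · have h2 : |ℓ.im| < 2 * (Real.pi / q) := hℓ
    have h3 : ((q : ℂ) * ℓ).im = q * ℓ.im := by simp
    rw [h3, abs_mul, abs_of_pos hq0]
    calc q * |ℓ.im| < q * (2 * (Real.pi / q)) := by gcongr
      _ = 2 * Real.pi := by field_simp

lemma norm_inv_one_sub_exp_le {x : ℂ} (hx : 1 ≤ |x.re|) : ‖(1 - Complex.exp x)⁻¹‖ ≤ 2 := by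
  rw [norm_inv]
  have he : (2.7 : ℝ) < Real.exp 1 := by have := Real.exp_one_gt_d9; linarith
  have hn := Complex.norm_exp x
  refine inv_le_of_inv_le₀ (by norm_num) ?_
  rcases le_abs.1 hx with h | h
  · have h1 : Real.exp 1 ≤ ‖Complex.exp x‖ := by rw [hn]; exact Real.exp_le_exp.2 h
    have := norm_sub_norm_le (Complex.exp x) 1
    rw [norm_sub_rev, norm_one] at this
    linarith
  · have h1 : ‖Complex.exp x‖ ≤ Real.exp (-1) := by rw [hn]; exact Real.exp_le_exp.2 (by linarith)
    have h2 : Real.exp (-1) ≤ 1 / 2 := by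
      rw [Real.exp_neg]
      exact inv_le_of_inv_le₀ (by norm_num) (by norm_num; linarith)
    have := norm_sub_norm_le 1 (Complex.exp x)
    rw [norm_one] at this
    linarith

lemma exists_bound_powKernel {q : ℝ} (hq : 1 ≤ q) :
    ∃ C : ℝ, 0 < C ∧ ∀ ℓ : ℂ, |ℓ.im| ≤ 7 / 4 * (Real.pi / q) → ‖powKernel q ℓ‖ ≤ C := by
  have hq0 : 0 < q := by linarith
  have hpi := Real.pi_pos
  have hκ : 0 < Real.pi / q := by positivity
  have hK : IsCompact (Icc (-1 : ℝ) 1 ×ℂ Icc (-(7 / 4 * (Real.pi / q))) (7 / 4 * (Real.pi / q))) :=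
    isCompact_Icc.reProdIm isCompact_Icc
  obtain ⟨C, hC⟩ := hK.exists_bound_of_continuousOn (f := powKernel q)
    ((differentiableOn_powKernel hq).continuousOn.mono fun ℓ hℓ => by
      have := abs_le.2 hℓ.2
      simp only [mem_ofPred_eq]
      linarith)
  refine ⟨max C 5, by positivity, fun ℓ hℓ => ?_⟩
  rcases le_or_gt |ℓ.re| 1 with h | h
  · exact (hC ℓ ⟨abs_le.1 h, abs_le.1 hℓ⟩).trans (le_max_left _ _)
  · refine le_trans ?_ (le_max_right _ _)
    have h0 : ℓ ≠ 0 := by rintro rfl; simp at h; linarith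
    have h1 : 1 ≤ |((q : ℂ) * ℓ).re| := by
      have : ((q : ℂ) * ℓ).re = q * ℓ.re := by simp
      rw [this, abs_mul, abs_of_pos hq0]
      nlinarith
    have e1 : (1 - Complex.exp ℓ)⁻¹ * Complex.exp ℓ = (1 - Complex.exp ℓ)⁻¹ - 1 := by
      have : 1 - Complex.exp ℓ ≠ 0 := by
        intro h2
        have h3 := congrArg norm (sub_eq_zero.1 h2)
        rw [norm_one, Complex.norm_exp, eq_comm, Real.exp_eq_one_iff] at h3
        rw [h3] at h; simp at h; linarith
      field_simp
      ring
    rw [powKernel_of_ne hq h0, e1]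
    have n1 := norm_inv_one_sub_exp_le h1
    have n2 := norm_inv_one_sub_exp_le h.le
    have n3 : ‖(q : ℂ)⁻¹‖ ≤ 1 := by
      rw [norm_inv, Complex.norm_real, Real.norm_of_nonneg hq0.le]
      exact inv_le_one_of_one_le₀ hq
    have n4 : ‖(1 - Complex.exp ℓ)⁻¹ - 1‖ ≤ 3 := by
      refine (norm_sub_le _ _).trans ?_
      rw [norm_one]; linarith
    refine (norm_sub_le _ _).trans ?_
    rw [norm_mul]
    nlinarith [norm_nonneg (q : ℂ)⁻¹, norm_nonneg ((1 - Complex.exp ℓ)⁻¹ - 1)]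

lemma powKernel_real {q : ℝ} (hq : 1 ≤ q) {x : ℝ} (hx : x ≠ 0) :
    ∃ y : ℝ, 0 ≤ y ∧ powKernel q x = y := by
  have hq0 : 0 < q := by linarith
  refine ⟨(1 - Real.exp (q * x))⁻¹ - q⁻¹ * ((1 - Real.exp x)⁻¹ * Real.exp x), ?_, ?_⟩
  swap
  · rw [powKernel_of_ne hq (by exact_mod_cast hx)]
    push_cast
    rfl
  rw [sub_nonneg]
  rcases lt_or_gt_of_ne hx with h | h
  · have h1 : Real.exp x < 1 := by rw [Real.exp_lt_one_iff]; exact h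
    have h2 : Real.exp (q * x) < 1 := by rw [Real.exp_lt_one_iff]; nlinarith
    have h3 : 1 - Real.exp (q * x) ≤ -(q * x) := by linarith [Real.add_one_le_exp (q * x)]
    have h4 : -x ≤ Real.exp (-x) - 1 := by linarith [Real.add_one_le_exp (-x)]
    have h5 : (1 - Real.exp x)⁻¹ * Real.exp x = (Real.exp (-x) - 1)⁻¹ := by
      rw [Real.exp_neg]
      have := Real.exp_pos x
      have : 1 - Real.exp x ≠ 0 := by linarith
      field_simp
    rw [h5, ← mul_inv]
    refine inv_anti₀ (by linarith) ?_
    nlinarith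
  · have h1 : 1 < Real.exp x := by rw [Real.one_lt_exp_iff]; exact h
    have h2 : 1 < Real.exp (q * x) := by rw [Real.one_lt_exp_iff]; positivity
    have h3 : q * x ≤ Real.exp (q * x) - 1 := by linarith [Real.add_one_le_exp (q * x)]
    have h4 : 1 - Real.exp (-x) ≤ x := by linarith [Real.add_one_le_exp (-x)]
    have h6 : 0 < 1 - Real.exp (-x) := by
      have : Real.exp (-x) < 1 := by rw [Real.exp_lt_one_iff]; linarith
      linarith
    have h5 : (1 - Real.exp x)⁻¹ * Real.exp x = -(1 - Real.exp (-x))⁻¹ := by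
      rw [Real.exp_neg] at h6 ⊢
      have := Real.exp_pos x
      have h7 : 1 - Real.exp x ≠ 0 := by linarith
      have h8 : Real.exp x - 1 ≠ 0 := by linarith
      have h9 : 1 - (Real.exp x)⁻¹ = (Real.exp x - 1) / Real.exp x := by field_simp
      rw [h9, ← neg_sub]
      field_simp
    rw [h5, mul_neg, ← mul_inv, ← neg_sub (Real.exp (q * x)), inv_neg, neg_le_neg_iff]
    refine inv_anti₀ (by positivity) ?_
    nlinarith

/-- The average of `powKernel q (L - log t)` over the semicircle law. -/
noncomputable def semicircleKernel (u q : ℝ) (L : ℂ) : ℂ :=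
  ∫ t : ℝ, powKernel q (L - (Real.log t : ℂ)) ∂(semicircle u)

lemma measurable_powKernel_sub_log {q : ℝ} (hq : 1 ≤ q) (L : ℂ) :
    Measurable fun t : ℝ => powKernel q (L - (Real.log t : ℂ)) :=
  (measurable_powKernel hq).comp (by fun_prop)

lemma differentiableAt_semicircleKernel {u q C : ℝ} (hq : 1 ≤ q)
    (hC : ∀ ℓ : ℂ, |ℓ.im| ≤ 7 / 4 * (Real.pi / q) → ‖powKernel q ℓ‖ ≤ C) {L : ℂ} {ε : ℝ}
    (hε : 0 < ε) (hL : |L.im| + 2 * ε < 7 / 4 * (Real.pi / q)) :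
    DifferentiableAt ℂ (semicircleKernel u q) L := by
  have hq0 : 0 < q := by linarith
  have hpi := Real.pi_pos
  have hκ : 0 < Real.pi / q := by positivity
  have ho : IsOpen {ℓ : ℂ | |ℓ.im| < 2 * (Real.pi / q)} :=
    isOpen_lt (by fun_prop) (by fun_prop)
  have hball : ∀ x ∈ Metric.ball L ε, ∀ t : ℝ, |(x - (Real.log t : ℂ)).im| + ε < 7 / 4 * (Real.pi / q) := by
    intro x hx t
    have h1 : |(x - L).im| < ε := (Complex.abs_im_le_norm _).trans_lt (by rwa [← dist_eq_norm])
    have h2 : (x - (Real.log t : ℂ)).im = L.im + (x - L).im := by simp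
    have := abs_add_le L.im (x - L).im
    rw [h2]
    linarith
  have hdiff : ∀ x ∈ Metric.ball L ε, ∀ t : ℝ, HasDerivAt (powKernel q)
      (deriv (powKernel q) (x - (Real.log t : ℂ))) (x - (Real.log t : ℂ)) := by
    intro x hx t
    have h1 := hball x hx t
    exact ((differentiableOn_powKernel hq).differentiableAt (ho.mem_nhds (by
      simp only [mem_ofPred_eq]; linarith))).hasDerivAt
  have hbd : ∀ x ∈ Metric.ball L ε, ∀ t : ℝ,
      ‖deriv (powKernel q) (x - (Real.log t : ℂ))‖ ≤ C / ε := by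
    intro x hx t
    have h1 := hball x hx t
    have hcl : ∀ y ∈ Metric.closedBall (x - (Real.log t : ℂ)) ε, |y.im| ≤ 7 / 4 * (Real.pi / q) := by
      intro y hy
      have h2 : |(y - (x - (Real.log t : ℂ))).im| ≤ ε :=
        (Complex.abs_im_le_norm _).trans (by rw [← dist_eq_norm]; exact hy)
      have h3 := abs_add_le (x - (Real.log t : ℂ)).im (y - (x - (Real.log t : ℂ))).im
      rw [← Complex.add_im, add_sub_cancel] at h3
      linarith
    refine Complex.norm_deriv_le_of_forall_mem_sphere_norm_le hε ?_ fun y hy =>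
      hC y (hcl y (Metric.sphere_subset_closedBall hy))
    refine DifferentiableOn.diffContOnCl ((differentiableOn_powKernel hq).mono fun y hy => ?_)
    rw [closure_ball _ hε.ne'] at hy
    have := hcl y hy
    simp only [mem_ofPred_eq]; linarith
  have hLm : L ∈ Metric.ball L ε := Metric.mem_ball_self hε
  have key := hasDerivAt_integral_of_dominated_loc_of_deriv_le (μ := semicircle u) (𝕜 := ℂ)
    (F := fun L (t : ℝ) => powKernel q (L - (Real.log t : ℂ)))
    (F' := fun L (t : ℝ) => deriv (powKernel q) (L - (Real.log t : ℂ)))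
    (x₀ := L) (s := Metric.ball L ε) (bound := fun _ => C / ε)
    (Metric.ball_mem_nhds L hε)
    (Eventually.of_forall fun x => (measurable_powKernel_sub_log hq x).aestronglyMeasurable)
    (by
      refine Integrable.of_bound (measurable_powKernel_sub_log hq L).aestronglyMeasurable C
        (Eventually.of_forall fun t => hC _ ?_)
      have := hball L hLm t
      linarith)
    (by
      refine Measurable.aestronglyMeasurable ?_
      exact (measurable_deriv (powKernel q)).comp (by fun_prop))
    (Eventually.of_forall fun t x hx => hbd x hx t)
    (integrable_const _)
    (Eventually.of_forall fun t x hx => by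
      have := (hdiff x hx t).comp x ((hasDerivAt_id x).sub_const (Real.log t : ℂ))
      simpa [Function.comp_def] using this)
  exact key.2.differentiableAt

lemma semicircleKernel_bounds (u : ℝ) {q : ℝ} (hq : 1 ≤ q) : ∃ C : ℝ, 0 < C ∧
    (∀ L : ℂ, |L.im| ≤ 7 / 4 * (Real.pi / q) → ‖semicircleKernel u q L‖ ≤ C) ∧
    ∀ L : ℂ, |L.im| < 7 / 4 * (Real.pi / q) → DifferentiableAt ℂ (semicircleKernel u q) L := by
  obtain ⟨C, hC0, hC⟩ := exists_bound_powKernel hq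
  refine ⟨C, hC0, fun L hL => ?_, fun L hL => ?_⟩
  · refine (norm_integral_le_of_norm_le_const (C := C)
      (Eventually.of_forall fun t => hC _ ?_)).trans ?_
    · simpa using hL
    · simp
  · exact differentiableAt_semicircleKernel hq hC
      (ε := (7 / 4 * (Real.pi / q) - |L.im|) / 4) (by linarith) (by linarith)

lemma ae_pos_semicircle {u : ℝ} (hu : 2 ≤ u) : ∀ᵐ t ∂(semicircle u), 0 < t ∧ t < u + 2 := by
  filter_upwards [ae_mem_Ioo_semicircle u] with t ht
  exact ⟨by linarith [ht.1], ht.2⟩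

lemma ae_ne_semicircle (u x : ℝ) : ∀ᵐ t ∂(semicircle u), t ≠ x :=
  (semicircle_absolutelyContinuous u).ae_le (Measure.ae_ne volume x)

lemma semicircleKernel_real {u q : ℝ} (hu : 2 ≤ u) (hq : 1 ≤ q) (x : ℝ) :
    ∃ y : ℝ, 0 ≤ y ∧ semicircleKernel u q x = y := by
  refine ⟨∫ t, (powKernel q ((x - Real.log t : ℝ) : ℂ)).re ∂(semicircle u), ?_, ?_⟩
  · refine integral_nonneg_of_ae ?_
    filter_upwards [ae_pos_semicircle hu, ae_ne_semicircle u (Real.exp x)] with t ht ht2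
    have : x - Real.log t ≠ 0 := by
      rw [sub_ne_zero]
      rintro rfl
      exact ht2 (Real.exp_log ht.1).symm
    obtain ⟨y, hy, h⟩ := powKernel_real hq this
    rw [h]
    simpa using hy
  · rw [semicircleKernel]
    refine Eq.trans (integral_congr_ae ?_) integral_ofReal
    filter_upwards [ae_pos_semicircle hu, ae_ne_semicircle u (Real.exp x)] with t ht ht2
    have : x - Real.log t ≠ 0 := by
      rw [sub_ne_zero]
      rintro rfl
      exact ht2 (Real.exp_log ht.1).symm
    obtain ⟨y, hy, h⟩ := powKernel_real hq this
    rw [h, ← Complex.ofReal_sub, h]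
    simp

lemma tendsto_powKernel {q : ℝ} (hq : 1 ≤ q) :
    Tendsto (powKernel q) (comap Complex.re atBot) (𝓝 1) := by
  have hq0 : 0 < q := by linarith
  have h0 : Tendsto Complex.exp (comap Complex.re atBot) (𝓝 0) := Complex.tendsto_exp_comap_re_atBot
  have h1 : Tendsto (fun ℓ : ℂ => Complex.exp (q * ℓ)) (comap Complex.re atBot) (𝓝 0) := by
    refine h0.comp ?_
    rw [tendsto_comap_iff]
    have : Complex.re ∘ (fun ℓ : ℂ => (q : ℂ) * ℓ) = fun ℓ => q * ℓ.re := by ext; simp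
    rw [this]
    exact tendsto_comap.const_mul_atBot hq0
  have h2 : Tendsto (fun ℓ : ℂ => (1 - Complex.exp (q * ℓ))⁻¹ -
      (q : ℂ)⁻¹ * ((1 - Complex.exp ℓ)⁻¹ * Complex.exp ℓ)) (comap Complex.re atBot)
      (𝓝 ((1 - 0)⁻¹ - (q : ℂ)⁻¹ * ((1 - 0)⁻¹ * 0))) := by
    refine ((tendsto_const_nhds.sub h1).inv₀ (by simp)).sub
      (((tendsto_const_nhds.sub h0).inv₀ (by simp)).mul h0 |>.const_mul _)
  simp only [sub_zero, inv_one, mul_zero] at h2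
  refine h2.congr' ?_
  have : ∀ᶠ ℓ : ℂ in comap Complex.re atBot, ℓ.re < 0 := tendsto_comap.eventually (eventually_lt_atBot 0)
  filter_upwards [this] with ℓ hℓ
  rw [powKernel_of_ne hq]
  rintro rfl
  simp at hℓ

lemma tendsto_semicircleKernel (u : ℝ) {q : ℝ} (hq : 1 ≤ q) :
    Tendsto (semicircleKernel u q)
      (comap Complex.re atBot ⊓ 𝓟 {L | |L.im| ≤ 7 / 4 * (Real.pi / q)}) (𝓝 1) := by
  obtain ⟨C, hC0, hC⟩ := exists_bound_powKernel hq
  have h1 : (1 : ℂ) = ∫ t : ℝ, (1 : ℂ) ∂(semicircle u) := by simp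
  rw [h1]
  refine tendsto_integral_filter_of_dominated_convergence (fun _ => C)
    (Eventually.of_forall fun x => (measurable_powKernel_sub_log hq x).aestronglyMeasurable)
    ?_ (integrable_const _) (Eventually.of_forall fun t => ?_)
  · filter_upwards [mem_inf_of_right (mem_principal_self _)] with L hL
    refine Eventually.of_forall fun t => hC _ ?_
    simpa using hL
  · refine ((tendsto_powKernel hq).comp ?_).mono_left inf_le_left
    rw [tendsto_comap_iff]
    have : Complex.re ∘ (fun ℓ : ℂ => ℓ - (Real.log t : ℂ)) = fun ℓ => ℓ.re + - Real.log t := by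
      ext; simp [sub_eq_add_neg]
    rw [this]
    exact tendsto_atBot_add_const_right _ _ tendsto_comap

/-- The Cauchy transform of the law of `t ^ (-q)`, `t` semicircular. -/
noncomputable def powCauchy (u q : ℝ) (z : ℂ) : ℂ :=
  ∫ t : ℝ, (z - ((t ^ (-q) : ℝ) : ℂ))⁻¹ ∂(semicircle u)

lemma cauchyTransform_map_rpow (u r : ℝ) (z : ℂ) :
    cauchyTransform (Measure.map (fun x : ℝ => x ^ r) (semicircle u)) z = powCauchy u (-r) z := by
  rw [cauchyTransform, powCauchy, neg_neg, integral_map (by fun_prop)]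
  exact Measurable.aestronglyMeasurable (by fun_prop)

lemma integral_pos_of_ae_pos {α : Type*} [MeasurableSpace α] {μ : Measure α} [NeZero μ] {f : α → ℝ}
    (hf : Integrable f μ) (h : ∀ᵐ x ∂μ, 0 < f x) : 0 < ∫ x, f x ∂μ := by
  rw [integral_pos_iff_support_of_nonneg_ae (h.mono fun x hx => hx.le) hf, pos_iff_ne_zero]
  intro h0
  have h1 : ∀ᵐ x ∂μ, x ∉ Function.support f := measure_eq_zero_iff_ae_notMem.1 h0
  have h2 : ∀ᵐ _ ∂μ, False := by
    filter_upwards [h, h1] with x hx hx1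
    exact hx1 hx.ne'
  rw [eventually_false_iff_eq_bot, ae_eq_bot] at h2
  exact NeZero.ne μ h2

lemma aestronglyMeasurable_powCauchy (u q : ℝ) (z : ℂ) :
    AEStronglyMeasurable (fun t : ℝ => (z - ((t ^ (-q) : ℝ) : ℂ))⁻¹) (semicircle u) :=
  Measurable.aestronglyMeasurable (by fun_prop)

lemma norm_inv_sub_ofReal_le {z : ℂ} (hz : z.im ≠ 0) (x : ℝ) : ‖(z - (x : ℂ))⁻¹‖ ≤ |z.im|⁻¹ := by
  rw [norm_inv]
  refine inv_anti₀ (abs_pos.2 hz) ?_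
  simpa using Complex.abs_im_le_norm (z - (x : ℂ))

lemma integrable_powCauchy (u q : ℝ) {z : ℂ} (hz : z.im ≠ 0) :
    Integrable (fun t : ℝ => (z - ((t ^ (-q) : ℝ) : ℂ))⁻¹) (semicircle u) :=
  Integrable.of_bound (aestronglyMeasurable_powCauchy u q z) |z.im|⁻¹
    (Eventually.of_forall fun _ => norm_inv_sub_ofReal_le hz _)

lemma norm_powCauchy_le (u q : ℝ) {z : ℂ} (hz : z.im ≠ 0) : ‖powCauchy u q z‖ ≤ |z.im|⁻¹ := by
  refine (norm_integral_le_of_norm_le_const (C := |z.im|⁻¹)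
      (Eventually.of_forall fun _ => norm_inv_sub_ofReal_le hz _)).trans ?_
  simp

lemma ae_rpow_neg_ge {u q : ℝ} (hu : 2 ≤ u) (hq : 1 ≤ q) :
    ∀ᵐ t ∂(semicircle u), (u + 2) ^ (-q) ≤ t ^ (-q) := by
  filter_upwards [ae_pos_semicircle hu] with t ht
  exact Real.rpow_le_rpow_of_nonpos ht.1 ht.2.le (by linarith)

lemma im_inv_sub_ofReal (z : ℂ) (x : ℝ) : ((z - (x : ℂ))⁻¹).im = -z.im / Complex.normSq (z - x) := by
  simp [Complex.inv_im]

lemma re_inv_sub_ofReal (z : ℂ) (x : ℝ) :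
    ((z - (x : ℂ))⁻¹).re = (z.re - x) / Complex.normSq (z - x) := by
  simp [Complex.inv_re]

lemma im_powCauchy (u q : ℝ) {z : ℂ} (hz : z.im ≠ 0) :
    (powCauchy u q z).im = ∫ t : ℝ, ((z - ((t ^ (-q) : ℝ) : ℂ))⁻¹).im ∂(semicircle u) :=
  (integral_im (integrable_powCauchy u q hz)).symm

lemma re_powCauchy (u q : ℝ) {z : ℂ} (hz : z.im ≠ 0) :
    (powCauchy u q z).re = ∫ t : ℝ, ((z - ((t ^ (-q) : ℝ) : ℂ))⁻¹).re ∂(semicircle u) :=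
  (integral_re (integrable_powCauchy u q hz)).symm

lemma im_powCauchy_neg (u q : ℝ) {z : ℂ} (hz : 0 < z.im) : (powCauchy u q z).im < 0 := by
  rw [im_powCauchy u q hz.ne', ← neg_pos, ← integral_neg]
  refine integral_pos_of_ae_pos (integrable_powCauchy u q hz.ne').im.neg (Eventually.of_forall fun t => ?_)
  rw [im_inv_sub_ofReal, neg_div, neg_neg]
  refine div_pos hz (Complex.normSq_pos.2 fun h => ?_)
  have := congrArg Complex.im h
  simp at this
  exact hz.ne' this

lemma im_powCauchy_nonneg (u q : ℝ) {z : ℂ} (hz : z.im < 0) : 0 ≤ (powCauchy u q z).im := by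
  rw [im_powCauchy u q hz.ne]
  refine integral_nonneg fun t => ?_
  simp only [Pi.zero_apply, im_inv_sub_ofReal]
  exact div_nonneg (by linarith) (Complex.normSq_nonneg _)

lemma im_gt_of_powCauchy {u q γ : ℝ} (hu : 2 ≤ u) (hq : 1 ≤ q) {z : ℂ} (hz : 0 < z.im)
    (hz' : z.re ≤ (u + 2) ^ (-q) / 2)
    (h : γ * |(powCauchy u q z).re| < -(powCauchy u q z).im) :
    γ * (u + 2) ^ (-q) / 2 < z.im := by
  set a := (u + 2) ^ (-q) with ha
  have ha0 : 0 < a := Real.rpow_pos_of_pos (by linarith) _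
  have hi := integrable_powCauchy u q hz.ne'
  have key : -(powCauchy u q z).im ≤ (2 * z.im / a) * (-(powCauchy u q z).re) := by
    rw [im_powCauchy u q hz.ne', re_powCauchy u q hz.ne', ← integral_neg, ← integral_neg,
      ← integral_const_mul]
    refine integral_mono_ae hi.im.neg (hi.re.neg.const_mul _) ?_
    filter_upwards [ae_rpow_neg_ge hu hq] with t ht
    change -(Complex.im _) ≤ 2 * z.im / a * -(Complex.re _)
    rw [im_inv_sub_ofReal, re_inv_sub_ofReal, neg_div, neg_neg, ← neg_div, ← mul_div_assoc]
    refine div_le_div_of_nonneg_right ?_ (Complex.normSq_nonneg _)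
    rw [div_mul_eq_mul_div, le_div_iff₀ ha0]
    nlinarith
  have h1 : γ * |(powCauchy u q z).re| < (2 * z.im / a) * |(powCauchy u q z).re| := by
    refine h.trans_le (key.trans ?_)
    gcongr
    exact neg_le_abs _
  have h2 := lt_of_mul_lt_mul_right h1 (abs_nonneg _)
  rw [lt_div_iff₀ ha0] at h2
  linarith

lemma norm_powCauchy_le_of_small {u q : ℝ} (hu : 2 ≤ u) (hq : 1 ≤ q) {z : ℂ}
    (hz : ‖z‖ ≤ (u + 2) ^ (-q) / 2) : ‖powCauchy u q z‖ ≤ 2 / (u + 2) ^ (-q) := by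
  set a := (u + 2) ^ (-q) with ha
  have ha0 : 0 < a := Real.rpow_pos_of_pos (by linarith) _
  refine (norm_integral_le_of_norm_le_const (C := 2 / a) ?_).trans (by simp)
  filter_upwards [ae_rpow_neg_ge hu hq] with t ht
  rw [norm_inv, ← inv_div]
  refine inv_anti₀ (by positivity) ?_
  have h1 := norm_sub_norm_le ((t ^ (-q) : ℝ) : ℂ) z
  rw [norm_sub_rev, Complex.norm_real, Real.norm_eq_abs] at h1
  have := le_abs_self (t ^ (-q))
  linarith

lemma exists_re_powCauchy_le {u q : ℝ} (hu : 2 ≤ u) (hq : 1 ≤ q) :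
    ∃ c : ℝ, 0 < c ∧ ∀ x : ℝ, 0 < x → x < (u + 2) ^ (-q) → (powCauchy u q x).re ≤ -c := by
  have hint : Integrable (fun t : ℝ => t ^ q) (semicircle u) := by
    refine Integrable.of_bound (Measurable.aestronglyMeasurable (by fun_prop)) ((u + 2) ^ q) ?_
    filter_upwards [ae_pos_semicircle hu] with t ht
    rw [Real.norm_of_nonneg (Real.rpow_nonneg ht.1.le _)]
    exact Real.rpow_le_rpow ht.1.le ht.2.le (by linarith)
  refine ⟨∫ t, t ^ q ∂(semicircle u), integral_pos_of_ae_pos hint ?_, fun x hx hx' => ?_⟩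
  · filter_upwards [ae_pos_semicircle hu] with t ht
    exact Real.rpow_pos_of_pos ht.1 _
  have e : powCauchy u q x = ((∫ t : ℝ, (x - t ^ (-q))⁻¹ ∂(semicircle u) : ℝ) : ℂ) := by
    rw [powCauchy]
    refine Eq.trans (integral_congr_ae (Eventually.of_forall fun t => ?_)) integral_ofReal
    simp
  rw [e, Complex.ofReal_re, ← integral_neg]
  refine integral_mono_ae ?_ hint.neg ?_
  · refine Integrable.of_bound (Measurable.aestronglyMeasurable (by fun_prop)) ((u + 2) ^ (-q) - x)⁻¹ ?_
    filter_upwards [ae_rpow_neg_ge hu hq] with t ht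
    rw [norm_inv, Real.norm_eq_abs, abs_sub_comm]
    refine inv_anti₀ (by linarith) ?_
    have := le_abs_self (t ^ (-q) - x)
    linarith
  · filter_upwards [ae_rpow_neg_ge hu hq, ae_pos_semicircle hu] with t ht ht0
    change (x - t ^ (-q))⁻¹ ≤ - t ^ q
    rw [← neg_sub, inv_neg, neg_le_neg_iff, ← inv_inv (t ^ q), ← Real.rpow_neg ht0.1.le]
    exact inv_anti₀ (by linarith) (by linarith)

/-- The Joukowsky-type map `s ↦ u + s + s⁻¹`. -/
noncomputable def joukowsky (u : ℝ) (s : ℂ) : ℂ := u + s + s⁻¹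

/-- The transform of the power law in terms of the Joukowsky variable `s` and the logarithm `L` of
`joukowsky u s`. -/
noncomputable def liftedCauchy (u q : ℝ) (s L : ℂ) : ℂ :=
  Complex.exp (q * L) * (-(q : ℂ)⁻¹ * (Complex.exp L / s) + semicircleKernel u q L)

lemma liftedCauchy_eq_powCauchy {u q : ℝ} (hu : 2 ≤ u) (hq : 1 ≤ q) {s L : ℂ} (hs : 1 < ‖s‖)
    (hL : Complex.exp L = joukowsky u s) (hLim : |L.im| ≤ 7 / 4 * (Real.pi / q)) :
    liftedCauchy u q s L = powCauchy u q (Complex.exp (-(q * L))) := by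
  obtain ⟨hint, hne⟩ := integral_inv_sub_semicircle u hs
  change ∫ t : ℝ, (joukowsky u s - (t : ℂ))⁻¹ ∂(semicircle u) = s⁻¹ at hint
  change ∀ t ∈ Icc (u - 2) (u + 2), joukowsky u s - (t : ℂ) ≠ 0 at hne
  rw [← hL] at hint hne
  obtain ⟨C, -, hC⟩ := exists_bound_powKernel hq
  have i1 : Integrable (fun t : ℝ => powKernel q (L - (Real.log t : ℂ))) (semicircle u) :=
    Integrable.of_bound (measurable_powKernel_sub_log hq L).aestronglyMeasurable C
      (Eventually.of_forall fun t => hC _ (by simpa using hLim))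
  have i2 : Integrable (fun t : ℝ => (Complex.exp L - (t : ℂ))⁻¹) (semicircle u) := by
    obtain ⟨C', hC'⟩ := isCompact_Icc.exists_bound_of_continuousOn
      (ContinuousOn.inv₀ (f := fun t : ℝ => Complex.exp L - (t : ℂ)) (by fun_prop) hne)
    refine Integrable.of_bound (Measurable.aestronglyMeasurable (by fun_prop)) C' ?_
    filter_upwards [ae_mem_Ioo_semicircle u] with t ht
    exact hC' t (Ioo_subset_Icc_self ht)
  have hpt : powCauchy u q (Complex.exp (-(q * L))) = ∫ t : ℝ,
      (Complex.exp (q * L) * powKernel q (L - (Real.log t : ℂ)) -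
      (Complex.exp (q * L) * (q : ℂ)⁻¹ * Complex.exp L) * (Complex.exp L - (t : ℂ))⁻¹) ∂(semicircle u) := by
    refine integral_congr_ae ?_
    filter_upwards [ae_mem_Ioo_semicircle u, ae_pos_semicircle hu] with t ht ht0
    have hne' := hne t (Ioo_subset_Icc_self ht)
    have htc : (t : ℂ) ≠ 0 := by exact_mod_cast ht0.1.ne'
    have hlog : Complex.exp (Real.log t : ℂ) = t := by
      rw [← Complex.ofReal_exp, Real.exp_log ht0.1]
    have hℓ : L - (Real.log t : ℂ) ≠ 0 := by
      intro h
      rw [sub_eq_zero] at h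
      rw [h, hlog, sub_self] at hne'
      exact hne' rfl
    have e1 : Complex.exp (L - (Real.log t : ℂ)) = Complex.exp L / t := by
      rw [Complex.exp_sub, hlog]
    have e2 : Complex.exp (q * (L - (Real.log t : ℂ))) = Complex.exp (q * L) * ((t ^ (-q) : ℝ) : ℂ) := by
      rw [mul_sub, sub_eq_add_neg, Complex.exp_add, Real.rpow_def_of_pos ht0.1]
      push_cast
      ring_nf
    have e3 : (Complex.exp (-(q * L)) - ((t ^ (-q) : ℝ) : ℂ))⁻¹ =
        Complex.exp (q * L) * (1 - Complex.exp (q * L) * ((t ^ (-q) : ℝ) : ℂ))⁻¹ := by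
      rw [← inv_inv (Complex.exp (q * L)), ← Complex.exp_neg, ← mul_inv]
      congr 1
      rw [mul_sub, mul_one, ← mul_assoc, mul_inv_cancel₀ (Complex.exp_ne_zero _), one_mul]
    have e4 : (1 - Complex.exp L / t)⁻¹ * (Complex.exp L / t) =
        -(Complex.exp L * (Complex.exp L - (t : ℂ))⁻¹) := by
      have h1 : 1 - Complex.exp L / t = -((Complex.exp L - t) / t) := by
        field_simp
        ring
      rw [h1]
      field_simp
    rw [powKernel_of_ne hq hℓ, e1, e2, e3, e4]
    ring
  rw [hpt, integral_sub (i1.const_mul _) (i2.const_mul _), integral_const_mul, integral_const_mul,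
    hint, liftedCauchy, semicircleKernel]
  ring

lemma im_joukowsky (u : ℝ) (s : ℂ) :
    (joukowsky u s).im = s.im * (1 - (Complex.normSq s)⁻¹) := by
  simp only [joukowsky, Complex.add_im, Complex.ofReal_im, Complex.inv_im]
  rw [div_eq_mul_inv]
  ring

lemma joukowsky_inv (u : ℝ) (s : ℂ) : joukowsky u s⁻¹ = joukowsky u s := by
  simp only [joukowsky, inv_inv]
  ring

lemma continuousAt_joukowsky (u : ℝ) {s : ℂ} (hs : s ≠ 0) : ContinuousAt (joukowsky u) s := by
  unfold joukowsky
  exact (by fun_prop : ContinuousAt (fun s : ℂ => u + s) s).add (continuousAt_inv₀ hs)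

lemma im_joukowsky_neg_iff (u : ℝ) {s : ℂ} (hs : s.im < 0) : (joukowsky u s).im < 0 ↔ 1 < ‖s‖ := by
  have hs0 : s ≠ 0 := by rintro rfl; simp at hs
  have hn : 0 < Complex.normSq s := Complex.normSq_pos.2 hs0
  rw [im_joukowsky, mul_neg_iff]
  simp only [hs, hs.not_gt, false_and, true_and, false_or, sub_pos]
  rw [inv_lt_one₀ hn, Complex.normSq_eq_norm_sq, one_lt_sq_iff₀ (norm_nonneg _)]

lemma im_joukowsky_pos_iff (u : ℝ) {s : ℂ} (hs : s.im < 0) : 0 < (joukowsky u s).im ↔ ‖s‖ < 1 := by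
  have hs0 : s ≠ 0 := by rintro rfl; simp at hs
  have hn : 0 < Complex.normSq s := Complex.normSq_pos.2 hs0
  rw [im_joukowsky, mul_pos_iff]
  simp only [hs, hs.not_gt, false_and, true_and, false_or, sub_neg]
  rw [one_lt_inv₀ hn, Complex.normSq_eq_norm_sq, sq_lt_one_iff₀ (norm_nonneg _)]

lemma joukowsky_inj (u : ℝ) {s t : ℂ} (hs : s.im < 0) (ht : t.im < 0)
    (h : joukowsky u s = joukowsky u t) : s = t := by
  have hs0 : s ≠ 0 := by rintro rfl; simp at hs
  have ht0 : t ≠ 0 := by rintro rfl; simp at ht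
  have h1 : (s - t) * (s * t - 1) = 0 := by
    simp only [joukowsky] at h
    field_simp at h
    linear_combination h
  rcases mul_eq_zero.1 h1 with h2 | h2
  · exact sub_eq_zero.1 h2
  · have h3 : s = t⁻¹ := eq_inv_of_mul_eq_one_left (sub_eq_zero.1 h2)
    rw [h3, Complex.inv_im] at hs
    have := div_pos (neg_pos.2 ht) (Complex.normSq_pos.2 ht0)
    linarith

lemma exists_joukowsky_eq (u : ℝ) {ζ : ℂ} (hζ : ζ.im ≠ 0) : ∃ s : ℂ, s.im < 0 ∧ joukowsky u s = ζ := by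
  obtain ⟨d, hd⟩ := IsAlgClosed.exists_pow_nat_eq ((ζ - u) ^ 2 - 4) (n := 2) (by norm_num)
  have hmul : (ζ - u + d) / 2 * ((ζ - u - d) / 2) = 1 := by linear_combination -hd / 4
  set s := (ζ - u + d) / 2 with hs
  have hs0 : s ≠ 0 := left_ne_zero_of_mul_eq_one hmul
  have hJ : joukowsky u s = ζ := by
    rw [joukowsky, inv_eq_of_mul_eq_one_right hmul, hs]
    ring
  rcases lt_trichotomy s.im 0 with h | h | h
  · exact ⟨s, h, hJ⟩
  · rw [← hJ, im_joukowsky, h, zero_mul] at hζ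
    exact absurd rfl hζ
  · refine ⟨s⁻¹, ?_, by rw [joukowsky_inv, hJ]⟩
    rw [Complex.inv_im]
    exact div_neg_of_neg_of_pos (neg_neg_of_pos h) (Complex.normSq_pos.2 hs0)

/-- The domain in the Joukowsky variable. -/
def joukowskyDomain (u q : ℝ) : Set ℂ :=
  {s | s.im < 0 ∧ joukowsky u s ∈ Complex.slitPlane ∧ -(Real.pi / q) < (joukowsky u s).arg ∧
    (joukowsky u s).arg < Real.pi / (q + 1)}

/-- `liftedCauchy` along the principal logarithm. -/
noncomputable def joukowskyCauchy (u q : ℝ) (s : ℂ) : ℂ :=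
  liftedCauchy u q s (Complex.log (joukowsky u s))

lemma isOpen_joukowskyDomain (u q : ℝ) : IsOpen (joukowskyDomain u q) := by
  rw [isOpen_iff_mem_nhds]
  intro s hs
  have hs0 : s ≠ 0 := by rintro rfl; simpa using hs.1
  have hc := continuousAt_joukowsky u hs0
  have ha : ContinuousAt (fun s => (joukowsky u s).arg) s :=
    (Complex.continuousAt_arg hs.2.1).comp hc
  filter_upwards [(isOpen_lt Complex.continuous_im continuous_const).mem_nhds hs.1,
    hc.preimage_mem_nhds (Complex.isOpen_slitPlane.mem_nhds hs.2.1),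
    ha.preimage_mem_nhds (Ioo_mem_nhds hs.2.2.1 hs.2.2.2)] with x h1 h2 h3
  exact ⟨h1, h2, h3.1, h3.2⟩

lemma pi_div_add_one_lt {q : ℝ} (hq : 1 ≤ q) : Real.pi / (q + 1) < Real.pi / q :=
  div_lt_div_of_pos_left Real.pi_pos (by linarith) (by linarith)

lemma differentiableAt_liftedCauchy {u q : ℝ} (hq : 1 ≤ q) {f : ℂ → ℂ} {s : ℂ} (hs : s ≠ 0)
    (hf : DifferentiableAt ℂ f s) (hL : |(f s).im| < 7 / 4 * (Real.pi / q)) :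
    DifferentiableAt ℂ (fun s => liftedCauchy u q s (f s)) s := by
  obtain ⟨C, hC0, -, hd⟩ := semicircleKernel_bounds u hq
  unfold liftedCauchy
  have := (hd _ hL).comp s hf
  simp only [Function.comp_def] at this
  fun_prop (disch := assumption)

lemma differentiableOn_joukowskyCauchy (u : ℝ) {q : ℝ} (hq : 1 ≤ q) :
    DifferentiableOn ℂ (joukowskyCauchy u q) (joukowskyDomain u q) := by
  intro s hs
  have hs0 : s ≠ 0 := by rintro rfl; simpa using hs.1
  have hq0 : 0 < q := by linarith
  have hpi := Real.pi_pos
  have hκ : 0 < Real.pi / q := by positivity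
  refine (differentiableAt_liftedCauchy hq hs0 ?_ ?_).differentiableWithinAt
  · refine DifferentiableAt.clog ?_ hs.2.1
    unfold joukowsky
    fun_prop (disch := assumption)
  · rw [Complex.log_im]
    have := pi_div_add_one_lt hq
    have : |(joukowsky u s).arg| < Real.pi / q := abs_lt.2 ⟨hs.2.2.1, by linarith [hs.2.2.2]⟩
    linarith

lemma ne_zero_of_im_neg {s : ℂ} (hs : s.im < 0) : s ≠ 0 := by rintro rfl; simp at hs

lemma abs_arg_joukowsky_lt {u q : ℝ} (hq : 1 ≤ q) {s : ℂ} (hs : s ∈ joukowskyDomain u q) :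
    |(Complex.log (joukowsky u s)).im| < Real.pi / q := by
  rw [Complex.log_im]
  exact abs_lt.2 ⟨hs.2.2.1, hs.2.2.2.trans (pi_div_add_one_lt hq)⟩

lemma im_exp_neg_mul_pos {q : ℝ} (hq : 1 ≤ q) {L : ℂ} (h1 : -(Real.pi / q) < L.im) (h2 : L.im < 0) :
    0 < (Complex.exp (-(q * L))).im := by
  have hq0 : 0 < q := by linarith
  rw [Complex.exp_im]
  have e : (-((q : ℂ) * L)).im = q * -L.im := by simp
  rw [e]
  refine mul_pos (Real.exp_pos _) (Real.sin_pos_of_pos_of_lt_pi (by nlinarith) ?_)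
  calc q * -L.im < q * (Real.pi / q) := by gcongr; linarith
    _ = Real.pi := by field_simp

lemma joukowskyCauchy_eq_powCauchy {u q : ℝ} (hu : 2 ≤ u) (hq : 1 ≤ q) {s : ℂ}
    (hs : s ∈ joukowskyDomain u q) (h : 1 < ‖s‖) :
    0 < (Complex.exp (-(q * Complex.log (joukowsky u s)))).im ∧
    joukowskyCauchy u q s = powCauchy u q (Complex.exp (-(q * Complex.log (joukowsky u s)))) := by
  have hκ : 0 < Real.pi / q := div_pos Real.pi_pos (by linarith)
  refine ⟨im_exp_neg_mul_pos hq ?_ ?_, liftedCauchy_eq_powCauchy hu hq h ?_ ?_⟩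
  · rw [Complex.log_im]; exact hs.2.2.1
  · rw [Complex.log_im, Complex.arg_neg_iff, im_joukowsky_neg_iff u hs.1]; exact h
  · exact Complex.exp_log (Complex.slitPlane_ne_zero hs.2.1)
  · have := abs_arg_joukowsky_lt hq hs
    linarith

lemma norm_exp_ofReal_mul_log (q : ℝ) {z : ℂ} (hz : z ≠ 0) :
    ‖Complex.exp (q * Complex.log z)‖ = ‖z‖ ^ q := by
  rw [Complex.norm_exp, Real.rpow_def_of_pos (norm_pos_iff.2 hz)]
  simp [Complex.log_re, mul_comm]

lemma norm_exp_neg_mul_log (q : ℝ) {z : ℂ} (hz : z ≠ 0) :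
    ‖Complex.exp (-(q * Complex.log z))‖ = ‖z‖ ^ (-q) := by
  have := norm_exp_ofReal_mul_log (-q) hz
  push_cast at this
  rwa [neg_mul] at this

lemma exists_joukowskyCauchy_bounds (u : ℝ) {q : ℝ} (hq : 1 ≤ q) : ∃ C : ℝ, 0 < C ∧
    ∀ s ∈ joukowskyDomain u q,
      ‖joukowskyCauchy u q s‖ ≤ ‖joukowsky u s‖ ^ q * (‖joukowsky u s‖ / (q * ‖s‖) + C) ∧
      ‖joukowsky u s‖ ^ q * (‖joukowsky u s‖ / (q * ‖s‖) - C) ≤ ‖joukowskyCauchy u q s‖ := by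
  obtain ⟨C, hC0, hC, -⟩ := semicircleKernel_bounds u hq
  refine ⟨C, hC0, fun s hs => ?_⟩
  have hq0 : 0 < q := by linarith
  have hκ : 0 < Real.pi / q := div_pos Real.pi_pos (by linarith)
  have hJ := hC (Complex.log (joukowsky u s)) (by
    have := abs_arg_joukowsky_lt hq hs
    linarith)
  have hζ := Complex.slitPlane_ne_zero hs.2.1
  have hn : ‖-(q : ℂ)⁻¹ * (joukowsky u s / s)‖ = ‖joukowsky u s‖ / (q * ‖s‖) := by
    rw [norm_mul, norm_neg, norm_inv, norm_div, Complex.norm_real, Real.norm_of_nonneg hq0.le]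
    field_simp
  rw [joukowskyCauchy, liftedCauchy, Complex.exp_log hζ, norm_mul, norm_exp_ofReal_mul_log q hζ]
  have hp : 0 ≤ ‖joukowsky u s‖ ^ q := by positivity
  constructor
  · refine mul_le_mul_of_nonneg_left ((norm_add_le _ _).trans ?_) hp
    rw [hn]
    gcongr
  · refine mul_le_mul_of_nonneg_left ?_ hp
    have := norm_sub_le_norm_add (-(q : ℂ)⁻¹ * (joukowsky u s / s)) (semicircleKernel u q (Complex.log (joukowsky u s)))
    rw [hn] at this
    linarith

lemma tendsto_norm_joukowsky_cobounded (u : ℝ) :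
    Tendsto (fun s => ‖joukowsky u s‖) (Bornology.cobounded ℂ) atTop := by
  have h : Tendsto (fun s : ℂ => ‖s‖ - ‖(u : ℂ)‖ - ‖s⁻¹‖) (Bornology.cobounded ℂ) atTop := by
    have h1 : Tendsto (fun s : ℂ => ‖s⁻¹‖) (Bornology.cobounded ℂ) (𝓝 0) := by
      simpa using (tendsto_inv₀_cobounded (α := ℂ)).norm
    exact ((tendsto_atTop_add_const_right _ (-‖(u : ℂ)‖) tendsto_norm_cobounded_atTop).atTop_add h1.neg).congr
      fun s => by ring
  refine tendsto_atTop_mono (fun s => ?_) h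
  have h1 := norm_sub_le (joukowsky u s) (u + s⁻¹)
  have h2 := norm_add_le (u : ℂ) s⁻¹
  have h3 : joukowsky u s - (u + s⁻¹) = s := by rw [joukowsky]; ring
  rw [h3] at h1
  linarith

lemma tendsto_norm_joukowsky_zero (u : ℝ) :
    Tendsto (fun s => ‖joukowsky u s‖) (𝓝[≠] 0) atTop := by
  have h : Tendsto (fun s : ℂ => s⁻¹) (𝓝[≠] 0) (Bornology.cobounded ℂ) := tendsto_inv₀_nhdsNE_zero
  exact ((tendsto_norm_joukowsky_cobounded u).comp h).congr fun s => by
    simp only [Function.comp_apply, joukowsky_inv]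

lemma tendsto_liftedCauchy {u q : ℝ} (hq : 1 ≤ q) {s L : ℂ} (hs : s ≠ 0)
    (hL : |L.im| < 7 / 4 * (Real.pi / q)) {α : Type*} {l : Filter α} {f g : α → ℂ}
    (hf : Tendsto f l (𝓝 s)) (hg : Tendsto g l (𝓝 L)) :
    Tendsto (fun x => liftedCauchy u q (f x) (g x)) l (𝓝 (liftedCauchy u q s L)) := by
  obtain ⟨C, hC0, -, hd⟩ := semicircleKernel_bounds u hq
  unfold liftedCauchy
  have h1 : Tendsto (fun x => semicircleKernel u q (g x)) l (𝓝 (semicircleKernel u q L)) :=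
    (hd L hL).continuousAt.tendsto.comp hg
  have h2 : Tendsto (fun x => Complex.exp (g x)) l (𝓝 (Complex.exp L)) :=
    (Complex.continuous_exp.tendsto L).comp hg
  have h3 : Tendsto (fun x => Complex.exp (q * g x)) l (𝓝 (Complex.exp (q * L))) :=
    (Complex.continuous_exp.tendsto _).comp (hg.const_mul _)
  exact h3.mul (((h2.div hf hs).const_mul _).add h1)

lemma liftedCauchy_inv {u q : ℝ} {s L : ℂ} :
    liftedCauchy u q s L = liftedCauchy u q s⁻¹ L -
      (q : ℂ)⁻¹ * Complex.exp ((q + 1) * L) * (s⁻¹ - s) := by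
  simp only [liftedCauchy]
  rw [add_mul, one_mul, Complex.exp_add]
  simp only [div_eq_mul_inv, inv_inv]
  ring

lemma Ultrafilter.le_cobounded_or_exists_le_nhds (𝒰 : Ultrafilter ℂ) :
    (𝒰 : Filter ℂ) ≤ Bornology.cobounded ℂ ∨ ∃ s, (𝒰 : Filter ℂ) ≤ 𝓝 s := by
  by_cases h : ∃ K ∈ 𝒰, IsCompact K
  · obtain ⟨K, hK, hKc⟩ := h
    obtain ⟨s, -, hs⟩ := hKc.ultrafilter_le_nhds' 𝒰 hK
    exact Or.inr ⟨s, hs⟩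
  · left
    push Not at h
    rw [Metric.cobounded_eq_cocompact]
    intro A hA
    obtain ⟨K, hK, hKA⟩ := mem_cocompact.1 hA
    refine mem_of_superset ?_ hKA
    exact Ultrafilter.compl_mem_iff_notMem.2 fun h1 => h K h1 hK

/-- Escape to the boundary of the upper half-plane `exp (-q L)` side is impossible inside a cone. -/
lemma frequently_false_of_powCauchy {u q γ : ℝ} (hu : 2 ≤ u) (hq : 1 ≤ q) (hγ : 0 < γ) {l : Filter ℂ} [NeBot l]
    {s₀ : ℂ} (hs₀ : s₀.im = 0) (hs₀' : s₀.re ≤ 0)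
    (hD : ∀ᶠ s in l, s ∈ joukowskyDomain u q ∧ 1 < ‖s‖)
    (hcone : ∀ᶠ s in l, γ * |(joukowskyCauchy u q s).re| < -(joukowskyCauchy u q s).im)
    (hz : Tendsto (fun s => Complex.exp (-(q * Complex.log (joukowsky u s)))) l (𝓝 s₀)) : False := by
  have ha : 0 < (u + 2) ^ (-q) := Real.rpow_pos_of_pos (by linarith) _
  have hre := (Complex.continuous_re.tendsto _).comp hz
  have him := (Complex.continuous_im.tendsto _).comp hz
  have h1 := hre.eventually (gt_mem_nhds (show s₀.re < (u + 2) ^ (-q) / 2 by linarith))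
  have h2 := him.eventually (gt_mem_nhds (show s₀.im < γ * (u + 2) ^ (-q) / 2 by rw [hs₀]; positivity))
  obtain ⟨s, ⟨hs, hs1⟩, hc, h1, h2⟩ := (hD.and (hcone.and (h1.and h2))).exists
  obtain ⟨e1, e2⟩ := joukowskyCauchy_eq_powCauchy hu hq hs hs1
  rw [e2] at hc
  have := im_gt_of_powCauchy hu hq e1 h1.le hc
  simp only [Function.comp_apply] at h2
  linarith

/-- Boundary behaviour of `joukowskyCauchy`. -/
lemma joukowskyCauchy_limit_cases {u q γ : ℝ} (hu : 2 ≤ u) (hq : 1 ≤ q) (hγ : 0 < γ)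
    (𝒰 : Ultrafilter ℂ) (hD : joukowskyDomain u q ∈ 𝒰)
    (hcone : ∀ᶠ s in (𝒰 : Filter ℂ), γ * |(joukowskyCauchy u q s).re| < -(joukowskyCauchy u q s).im)
    {w : ℂ} (hw : Tendsto (joukowskyCauchy u q) 𝒰 (𝓝 w)) :
    (∃ s ∈ joukowskyDomain u q, (𝒰 : Filter ℂ) ≤ 𝓝 s) ∨
    (∃ s : ℂ, s ≠ 0 ∧ joukowsky u s = 0 ∧ (𝒰 : Filter ℂ) ≤ 𝓝 s) ∨
    (∃ x : ℝ, x ≠ 0 ∧ 0 < u + x + x⁻¹ ∧ w = liftedCauchy u q x (Real.log (u + x + x⁻¹))) := by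
  have hq0 : 0 < q := by linarith
  have hpi := Real.pi_pos
  have hκ : 0 < Real.pi / q := by positivity
  have hDe : ∀ᶠ s in (𝒰 : Filter ℂ), s ∈ joukowskyDomain u q := hD
  rcases 𝒰.le_cobounded_or_exists_le_nhds with hinf | ⟨s₀, hs₀⟩
  · exfalso
    refine frequently_false_of_powCauchy hu hq hγ (s₀ := 0) (l := (𝒰 : Filter ℂ)) rfl le_rfl ?_ hcone ?_
    · filter_upwards [hDe, hinf (tendsto_norm_cobounded_atTop.eventually (eventually_gt_atTop 1))]
        with s h1 h2 using ⟨h1, h2⟩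
    · rw [tendsto_zero_iff_norm_tendsto_zero]
      have h1 := (tendsto_norm_joukowsky_cobounded u).mono_left hinf
      refine ((tendsto_rpow_neg_atTop hq0).comp h1).congr' ?_
      filter_upwards [hDe] with s hs
      exact (norm_exp_neg_mul_log q (Complex.slitPlane_ne_zero hs.2.1)).symm
  by_cases h0 : s₀ = 0
  · exfalso
    subst h0
    obtain ⟨C, hC0, hC⟩ := exists_joukowskyCauchy_bounds u hq
    have hne : (𝒰 : Filter ℂ) ≤ 𝓝[≠] 0 := by
      refine le_inf hs₀ (le_principal_iff.2 ?_)
      filter_upwards [hDe] with s hs using ne_zero_of_im_neg hs.1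
    have h1 := (tendsto_norm_joukowsky_zero u).mono_left hne
    have h2 : Tendsto (fun s => ‖joukowskyCauchy u q s‖) 𝒰 atTop := by
      refine tendsto_atTop_mono' _ ?_ (tendsto_atTop_add_const_right _ (-C)
        (h1.const_mul_atTop (show 0 < q⁻¹ by positivity)))
      filter_upwards [hDe, h1.eventually (eventually_ge_atTop (max 1 (q * C))),
        hs₀ (Metric.ball_mem_nhds 0 one_pos)] with s hs hs1 hs2
      have hs3 : ‖s‖ < 1 := by simpa using hs2
      have hs4 : 0 < ‖s‖ := norm_pos_iff.2 (ne_zero_of_im_neg hs.1)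
      have e1 : 1 ≤ ‖joukowsky u s‖ := (le_max_left _ _).trans hs1
      have e2 : q * C ≤ ‖joukowsky u s‖ := (le_max_right _ _).trans hs1
      have e3 : 1 ≤ ‖joukowsky u s‖ ^ q := Real.one_le_rpow e1 hq0.le
      have e4 : q⁻¹ * ‖joukowsky u s‖ ≤ ‖joukowsky u s‖ / (q * ‖s‖) := by
        rw [inv_mul_eq_div]
        refine div_le_div_of_nonneg_left (by positivity) (by positivity) ?_
        nlinarith
      have e5 : 0 ≤ q⁻¹ * ‖joukowsky u s‖ - C := by
        rw [inv_mul_eq_div, sub_nonneg, le_div_iff₀ hq0]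
        linarith
      have := (hC s hs).2
      nlinarith
    exact not_tendsto_nhds_of_tendsto_atTop h2 _ hw.norm
  by_cases hζ0 : joukowsky u s₀ = 0
  · exact Or.inr (Or.inl ⟨s₀, h0, hζ0, hs₀⟩)
  have him0 : s₀.im ≤ 0 := by
    refine le_of_tendsto ((Complex.continuous_im.tendsto s₀).mono_left hs₀) ?_
    filter_upwards [hDe] with s hs using hs.1.le
  have hζ : Tendsto (joukowsky u) 𝒰 (𝓝 (joukowsky u s₀)) := (continuousAt_joukowsky u h0).mono_left hs₀
  obtain ⟨θ, hθ, hθlim⟩ := (isCompact_Icc (a := -(Real.pi / q)) (b := Real.pi / (q + 1))).ultrafilter_le_nhds'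
    (𝒰.map fun s => (joukowsky u s).arg) (by
      rw [Ultrafilter.mem_map]
      filter_upwards [hDe] with s hs using ⟨hs.2.2.1.le, hs.2.2.2.le⟩)
  have hθt : Tendsto (fun s => (joukowsky u s).arg) 𝒰 (𝓝 θ) := hθlim
  set Ls : ℂ := (Real.log ‖joukowsky u s₀‖ : ℂ) + θ * Complex.I with hLs
  have hLim : Ls.im = θ := by simp [hLs]
  have hL : Tendsto (fun s => Complex.log (joukowsky u s)) 𝒰 (𝓝 Ls) := by
    have h1 : Tendsto (fun s => (Real.log ‖joukowsky u s‖ : ℂ)) 𝒰 (𝓝 (Real.log ‖joukowsky u s₀‖ : ℂ)) :=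
      (Complex.continuous_ofReal.tendsto _).comp (hζ.norm.log (norm_ne_zero_iff.2 hζ0))
    exact h1.add (((Complex.continuous_ofReal.tendsto _).comp hθt).mul_const _)
  have hexpL : Complex.exp Ls = joukowsky u s₀ := by
    refine tendsto_nhds_unique ((Complex.continuous_exp.tendsto _).comp hL) (hζ.congr' ?_)
    filter_upwards [hDe] with s hs
    exact (Complex.exp_log (Complex.slitPlane_ne_zero hs.2.1)).symm
  have hlt := pi_div_add_one_lt hq
  have hwL : w = liftedCauchy u q s₀ Ls := by
    refine tendsto_nhds_unique hw (tendsto_liftedCauchy (f := fun s => s) hq h0 ?_ hs₀ hL)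
    rw [hLim]
    have : |θ| ≤ Real.pi / q := abs_le.2 ⟨hθ.1, hθ.2.trans hlt.le⟩
    linarith
  have hcim : ∀ᶠ s in (𝒰 : Filter ℂ), (joukowskyCauchy u q s).im < 0 := by
    filter_upwards [hcone] with s hs
    have : 0 ≤ γ * |(joukowskyCauchy u q s).re| := by positivity
    linarith
  have hwim : w.im ≤ 0 :=
    le_of_tendsto ((Complex.continuous_im.tendsto w).comp hw) (hcim.mono fun s hs => hs.le)
  rcases hθ.1.eq_or_lt with hθ1 | hθ1
  · exfalso
    refine frequently_false_of_powCauchy hu hq hγ (s₀ := Complex.exp (-(q * Ls))) (l := (𝒰 : Filter ℂ)) ?_ ?_ ?_ hcone ?_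
    · rw [Complex.exp_im]
      have : (-((q : ℂ) * Ls)).im = Real.pi := by
        simp only [Complex.neg_im, Complex.im_ofReal_mul, hLim, ← hθ1]
        field_simp
      rw [this]; simp
    · rw [Complex.exp_re]
      have : (-((q : ℂ) * Ls)).im = Real.pi := by
        simp only [Complex.neg_im, Complex.im_ofReal_mul, hLim, ← hθ1]
        field_simp
      rw [this]; simp
      positivity
    · filter_upwards [hDe, hθt.eventually (gt_mem_nhds (show θ < 0 by linarith))] with s hs h1
      refine ⟨hs, ?_⟩
      rwa [Complex.arg_neg_iff, im_joukowsky_neg_iff u hs.1] at h1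
    · exact (Complex.continuous_exp.tendsto _).comp (hL.const_mul _).neg
  rcases hθ.2.eq_or_lt with hθ2 | hθ2
  · exfalso
    have hθ3 : 0 < θ := by rw [hθ2]; positivity
    have hθ4 : θ < Real.pi := by rw [hθ2]; exact div_lt_self hpi (by linarith)
    have hζim : 0 < (joukowsky u s₀).im := by
      rw [← hexpL, Complex.exp_im, hLim]
      exact mul_pos (Real.exp_pos _) (Real.sin_pos_of_pos_of_lt_pi hθ3 hθ4)
    have him1 : s₀.im < 0 := by
      refine lt_of_le_of_ne him0 fun h => ?_
      rw [im_joukowsky, h, zero_mul] at hζim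
      exact lt_irrefl _ hζim
    have hn := (im_joukowsky_pos_iff u him1).1 hζim
    have hn' : 1 < ‖s₀⁻¹‖ := by
      rw [norm_inv]
      exact (one_lt_inv₀ (norm_pos_iff.2 h0)).2 hn
    rw [hwL, liftedCauchy_inv, liftedCauchy_eq_powCauchy hu hq hn' (by rw [joukowsky_inv, hexpL])
      (by rw [hLim, abs_of_pos hθ3]; linarith)] at hwim
    have e1 : (Complex.exp (-(q * Ls))).im < 0 := by
      rw [Complex.exp_im]
      have : (-((q : ℂ) * Ls)).im = -(q * θ) := by simp [hLim]
      rw [this, Real.sin_neg]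
      have : 0 < Real.sin (q * θ) := by
        refine Real.sin_pos_of_pos_of_lt_pi (by positivity) ?_
        calc q * θ < q * (Real.pi / q) := by gcongr; linarith
          _ = Real.pi := by field_simp
      have := mul_pos (Real.exp_pos (-((q : ℂ) * Ls)).re) this
      linarith
    have e2 := im_powCauchy_nonneg u q e1
    have e3 : Complex.exp ((q + 1) * Ls) = -(Real.exp ((q + 1) * Ls.re) : ℂ) := by
      have h1 : ((q : ℂ) + 1) * Ls = (((q + 1) * Ls.re : ℝ) : ℂ) + Real.pi * Complex.I := by
        apply Complex.ext
        · simp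
        · have : (q + 1) * θ = Real.pi := by rw [hθ2]; field_simp
          simp [hLim]
          linarith
      rw [h1, Complex.exp_add, Complex.exp_pi_mul_I, Complex.ofReal_exp]
      ring
    have e4 : 0 < (s₀⁻¹ - s₀).im := by
      rw [Complex.sub_im, Complex.inv_im]
      have := div_pos (neg_pos.2 him1) (Complex.normSq_pos.2 h0)
      linarith
    rw [e3] at hwim
    have e5 : (q : ℂ)⁻¹ * -(Real.exp ((q + 1) * Ls.re) : ℂ) * (s₀⁻¹ - s₀) =
        ((-(q⁻¹ * Real.exp ((q + 1) * Ls.re)) : ℝ) : ℂ) * (s₀⁻¹ - s₀) := by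
      push_cast; ring
    rw [e5, Complex.sub_im, Complex.im_ofReal_mul] at hwim
    have := mul_pos (mul_pos (inv_pos.2 hq0) (Real.exp_pos ((q + 1) * Ls.re))) e4
    linarith
  have hθpi1 : -Real.pi < θ := by
    have : Real.pi / q ≤ Real.pi := div_le_self hpi.le hq
    linarith
  have hθpi2 : θ < Real.pi := by
    have : Real.pi / q ≤ Real.pi := div_le_self hpi.le hq
    linarith
  rcases him0.lt_or_eq with him1 | him1
  · left
    have harg : (joukowsky u s₀).arg = θ := by
      rw [← Complex.log_im, ← hexpL, Complex.log_exp (by rw [hLim]; exact hθpi1) (by rw [hLim]; exact hθpi2.le), hLim]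
    refine ⟨s₀, ⟨him1, ?_, ?_, ?_⟩, hs₀⟩
    · rw [Complex.mem_slitPlane_iff_arg, harg]
      exact ⟨hθpi2.ne, hζ0⟩
    · rw [harg]; exact hθ1
    · rw [harg]; exact hθ2
  · right; right
    have hζim : (joukowsky u s₀).im = 0 := by rw [im_joukowsky, him1, zero_mul]
    have hθ0 : θ = 0 := by
      rw [← hexpL, Complex.exp_im, hLim] at hζim
      rcases mul_eq_zero.1 hζim with h | h
      · exact absurd h (Real.exp_pos _).ne'
      · exact (Real.sin_eq_zero_iff_of_lt_of_lt hθpi1 hθpi2).1 h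
    have hs0r : s₀ = (s₀.re : ℂ) := by
      apply Complex.ext <;> simp [him1]
    have hζr : joukowsky u s₀ = ((u + s₀.re + s₀.re⁻¹ : ℝ) : ℂ) := by
      rw [joukowsky]; push_cast; rw [← hs0r]
    have hLr : Ls = (Real.log ‖joukowsky u s₀‖ : ℂ) := by simp [hLs, hθ0]
    have hpos : u + s₀.re + s₀.re⁻¹ = ‖joukowsky u s₀‖ := by
      have h1 : joukowsky u s₀ = (‖joukowsky u s₀‖ : ℂ) := by
        rw [← hexpL, hLr, ← Complex.ofReal_exp, Complex.norm_real, Real.norm_of_nonneg (Real.exp_pos _).le]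
      have h2 := hζr.symm.trans h1
      exact_mod_cast h2
    refine ⟨s₀.re, fun h => h0 (by rw [hs0r, h]; simp), ?_, ?_⟩
    · rw [hpos]; exact norm_pos_iff.2 hζ0
    · rw [hwL, hpos, hLr, ← hs0r]

lemma exists_joukowsky_path {u q : ℝ} (hu : 2 ≤ u) (hq : 1 ≤ q) {y : ℝ} (hy : 0 < y) :
    ∃ s ∈ joukowskyDomain u q, joukowskyCauchy u q s = powCauchy u q (y * Complex.I) ∧
      ‖joukowsky u s‖ = Real.exp (-Real.log y / q) := by
  have hq0 : 0 < q := by linarith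
  have hpi := Real.pi_pos
  have hκ : 0 < Real.pi / q := by positivity
  have hκ' : Real.pi / q ≤ Real.pi := div_le_self hpi.le hq
  set L : ℂ := ((-Real.log y / q : ℝ) : ℂ) + ((-(Real.pi / q / 2) : ℝ) : ℂ) * Complex.I with hL
  have hre : L.re = -Real.log y / q := by simp [hL]
  have him : L.im = -(Real.pi / q / 2) := by simp [hL]
  have hlog : Complex.log (Complex.exp L) = L := Complex.log_exp (by linarith) (by linarith)
  have hLim : (Complex.exp L).im < 0 := by
    rw [← Complex.arg_neg_iff, ← Complex.log_im, hlog, him]; linarith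
  obtain ⟨s, hs, hsζ⟩ := exists_joukowsky_eq u hLim.ne
  have hD : s ∈ joukowskyDomain u q := by
    refine ⟨hs, ?_, ?_, ?_⟩
    · rw [hsζ]; exact Or.inr hLim.ne
    · rw [hsζ, ← Complex.log_im, hlog, him]; linarith
    · rw [hsζ, ← Complex.log_im, hlog, him]
      have : 0 < Real.pi / (q + 1) := by positivity
      linarith
  refine ⟨s, hD, ?_, ?_⟩
  · rw [(joukowskyCauchy_eq_powCauchy hu hq hD ?_).2, hsζ, hlog]
    · congr 1
      have : -((q : ℂ) * L) = (Real.log y : ℂ) + Real.pi / 2 * Complex.I := by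
        have : (q : ℂ) ≠ 0 := by exact_mod_cast hq0.ne'
        rw [hL]; push_cast; field_simp; ring
      rw [this, Complex.exp_add, Complex.exp_pi_div_two_mul_I, ← Complex.ofReal_exp, Real.exp_log hy]
    · rw [← im_joukowsky_neg_iff u hs, hsζ]; exact hLim
  · rw [hsζ, Complex.norm_exp, hre]

/-- `s * joukowsky u s` in the logarithmic variable `log s`. -/
noncomputable def joukowskyNum (u : ℝ) (l : ℂ) : ℂ := 1 + (u * Complex.exp l + Complex.exp (2 * l))

/-- The second factor of `joukowskyCauchy` in the logarithmic variable. -/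
noncomputable def joukowskyFactor (u q : ℝ) (l : ℂ) : ℂ :=
  1 - q * Complex.exp (2 * l) / joukowskyNum u l *
    semicircleKernel u q (-l + Complex.log (joukowskyNum u l))

/-- The logarithmic remainder of `joukowskyCauchy` near `0`. -/
noncomputable def joukowskyRem (u q : ℝ) (l : ℂ) : ℂ :=
  -(q + 1) * Complex.log (joukowskyNum u l) - Complex.log (joukowskyFactor u q l)

lemma joukowskyRem_small (u : ℝ) {q : ℝ} (hq : 1 ≤ q) {ε : ℝ} (hε : 0 < ε) :
    ∃ A : ℝ, ∀ l : ℂ, l.re ≤ A → |l.im| ≤ 3 / 2 * (Real.pi / q) →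
      joukowskyNum u l ≠ 0 ∧ ‖Complex.log (joukowskyNum u l)‖ < ε ∧ joukowskyFactor u q l ≠ 0 ∧
      ‖joukowskyRem u q l‖ < ε ∧ DifferentiableAt ℂ (joukowskyRem u q) l := by
  have hq0 : 0 < q := by linarith
  have hpi := Real.pi_pos
  have hκ : 0 < Real.pi / q := by positivity
  obtain ⟨C, hC0, hC, hd⟩ := semicircleKernel_bounds u hq
  set F : Filter ℂ := comap Complex.re atBot ⊓ 𝓟 {l | |l.im| ≤ 3 / 2 * (Real.pi / q)} with hF
  suffices h : ∀ᶠ l in F, joukowskyNum u l ≠ 0 ∧ ‖Complex.log (joukowskyNum u l)‖ < ε ∧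
      joukowskyFactor u q l ≠ 0 ∧
      ‖joukowskyRem u q l‖ < ε ∧ DifferentiableAt ℂ (joukowskyRem u q) l by
    rw [hF, eventually_inf_principal, eventually_comap, eventually_atBot] at h
    obtain ⟨A, hA⟩ := h
    exact ⟨A, fun l h1 h2 => hA l.re h1 l rfl h2⟩
  have hexp : Tendsto Complex.exp F (𝓝 0) := Complex.tendsto_exp_comap_re_atBot.mono_left inf_le_left
  have hexp2 : Tendsto (fun l : ℂ => Complex.exp (2 * l)) F (𝓝 0) := by
    have := hexp.mul hexp
    rw [mul_zero] at this
    refine this.congr fun l => ?_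
    rw [← Complex.exp_add, two_mul]
  have hN : Tendsto (joukowskyNum u) F (𝓝 1) := by
    have := (tendsto_const_nhds (x := (1 : ℂ))).add ((hexp.const_mul (u : ℂ)).add hexp2)
    rw [mul_zero, add_zero, add_zero] at this
    exact this
  have hlogN : Tendsto (fun l => Complex.log (joukowskyNum u l)) F (𝓝 0) := by
    have := hN.clog Complex.one_mem_slitPlane
    rwa [Complex.log_one] at this
  have hLim : ∀ᶠ l in F, |(-l + Complex.log (joukowskyNum u l)).im| < 7 / 4 * (Real.pi / q) := by
    have h1 := hlogN.norm.eventually (gt_mem_nhds (show ‖(0 : ℂ)‖ < 1 / 4 * (Real.pi / q) by simp; positivity))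
    filter_upwards [h1, mem_inf_of_right (mem_principal_self _)] with l h1 h2
    have h3 := Complex.abs_im_le_norm (Complex.log (joukowskyNum u l))
    have h4 := abs_add_le (-l.im) (Complex.log (joukowskyNum u l)).im
    rw [abs_neg] at h4
    have h5 : |l.im| ≤ 3 / 2 * (Real.pi / q) := h2
    rw [Complex.add_im, Complex.neg_im]
    linarith
  have hfac : Tendsto (joukowskyFactor u q) F (𝓝 1) := by
    have h1 : Tendsto (fun l : ℂ => q * Complex.exp (2 * l) / joukowskyNum u l) F (𝓝 0) := by
      have := (hexp2.const_mul (q : ℂ)).div hN one_ne_zero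
      rw [mul_zero, zero_div] at this
      exact this
    have h2 : Tendsto (fun l : ℂ => q * Complex.exp (2 * l) / joukowskyNum u l *
        semicircleKernel u q (-l + Complex.log (joukowskyNum u l))) F (𝓝 0) := by
      refine squeeze_zero_norm' (a := fun l => ‖q * Complex.exp (2 * l) / joukowskyNum u l‖ * C) ?_ ?_
      · filter_upwards [hLim] with l hl
        rw [norm_mul]
        exact mul_le_mul_of_nonneg_left (hC _ hl.le) (norm_nonneg _)
      · simpa using h1.norm.mul_const C
    have := (tendsto_const_nhds (x := (1 : ℂ))).sub h2
    rw [sub_zero] at this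
    exact this
  have hrem : Tendsto (joukowskyRem u q) F (𝓝 0) := by
    have h1 := hfac.clog Complex.one_mem_slitPlane
    rw [Complex.log_one] at h1
    have h2 := (hlogN.const_mul (-((q : ℂ) + 1))).sub h1
    simp only [mul_zero, sub_zero] at h2
    exact h2
  have hslit : Complex.slitPlane ∈ 𝓝 (1 : ℂ) :=
    Complex.isOpen_slitPlane.mem_nhds Complex.one_mem_slitPlane
  filter_upwards [hN hslit, hfac hslit, hLim,
    hlogN.norm.eventually (gt_mem_nhds (show ‖(0 : ℂ)‖ < ε by simpa)),
    hrem.norm.eventually (gt_mem_nhds (show ‖(0 : ℂ)‖ < ε by simpa))] with l h1 h2 h3 h4 h5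
  refine ⟨Complex.slitPlane_ne_zero h1, h4, Complex.slitPlane_ne_zero h2, h5, ?_⟩
  have d1 : DifferentiableAt ℂ (joukowskyNum u) l := by unfold joukowskyNum; fun_prop
  have d2 : DifferentiableAt ℂ (fun l => Complex.log (joukowskyNum u l)) l := d1.clog h1
  have d3 : DifferentiableAt ℂ (fun l => semicircleKernel u q (-l + Complex.log (joukowskyNum u l))) l :=
    DifferentiableAt.comp (g := semicircleKernel u q)
      (f := fun l => -l + Complex.log (joukowskyNum u l)) l (hd _ h3) (differentiableAt_id.neg.add d2)
  have d4 : DifferentiableAt ℂ (joukowskyFactor u q) l := by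
    unfold joukowskyFactor
    refine DifferentiableAt.const_sub (DifferentiableAt.mul (DifferentiableAt.div (by fun_prop) d1
      (Complex.slitPlane_ne_zero h1)) d3) _
  exact (d2.const_mul _).sub (d4.clog h2)

lemma log_joukowsky_eq {u q : ℝ} (hq : 1 ≤ q) {s : ℂ} (hs : s ∈ joukowskyDomain u q) (hs1 : ‖s‖ < 1)
    (hN : joukowskyNum u (Complex.log s) ≠ 0) (hN1 : ‖Complex.log (joukowskyNum u (Complex.log s))‖ < 1) :
    Complex.log (joukowsky u s) = -Complex.log s + Complex.log (joukowskyNum u (Complex.log s)) := by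
  have hpi := Real.pi_gt_three
  have hs0 := ne_zero_of_im_neg hs.1
  have hζ := Complex.slitPlane_ne_zero hs.2.1
  have hE : Complex.exp (Complex.log (joukowsky u s)) =
      Complex.exp (-Complex.log s + Complex.log (joukowskyNum u (Complex.log s))) := by
    rw [Complex.exp_log hζ, Complex.exp_add, Complex.exp_neg, Complex.exp_log hs0, Complex.exp_log hN,
      joukowskyNum, two_mul, Complex.exp_add, Complex.exp_log hs0, joukowsky]
    field_simp
    ring
  obtain ⟨n, hn⟩ := Complex.exp_eq_exp_iff_exists_int.1 hE
  have him := congrArg Complex.im hn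
  have h1 : 0 ≤ (joukowsky u s).arg := by
    rw [Complex.arg_nonneg_iff]
    exact ((im_joukowsky_pos_iff u hs.1).2 hs1).le
  have h2 : (joukowsky u s).arg < Real.pi / 2 :=
    hs.2.2.2.trans_le (div_le_div_of_nonneg_left Real.pi_pos.le (by norm_num) (by linarith))
  have h3 : s.arg < 0 := Complex.arg_neg_iff.2 hs.1
  have h4 := Complex.neg_pi_lt_arg s
  have h5 := abs_lt.1 ((Complex.abs_im_le_norm _).trans_lt hN1)
  simp only [Complex.add_im, Complex.neg_im, Complex.log_im, Complex.mul_im, Complex.intCast_re,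
    Complex.intCast_im, Complex.mul_re, Complex.ofReal_re, Complex.ofReal_im, Complex.I_re,
    Complex.I_im, Complex.re_ofNat, Complex.im_ofNat] at him h5
  have hn0 : n = 0 := by
    have e1 : (-1 : ℝ) < n := by nlinarith
    have e2 : (n : ℝ) < 1 := by nlinarith
    have e1' : (-1 : ℤ) < n := by exact_mod_cast e1
    have e2' : n < 1 := by exact_mod_cast e2
    omega
  rw [hn, hn0]
  simp

lemma joukowskyCauchy_eq_exp {u q : ℝ} (hq : 1 ≤ q) {s : ℂ} (hs : s ∈ joukowskyDomain u q) (hs1 : ‖s‖ < 1)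
    (hN : joukowskyNum u (Complex.log s) ≠ 0) (hN1 : ‖Complex.log (joukowskyNum u (Complex.log s))‖ < 1)
    (hfac : joukowskyFactor u q (Complex.log s) ≠ 0) :
    -q * joukowskyCauchy u q s =
      Complex.exp (-((q + 2) * Complex.log s + joukowskyRem u q (Complex.log s))) := by
  have hq0 : (q : ℂ) ≠ 0 := by exact_mod_cast (by linarith : q ≠ 0)
  have hL := log_joukowsky_eq hq hs hs1 hN hN1
  have hs0 := ne_zero_of_im_neg hs.1
  have hζ := Complex.slitPlane_ne_zero hs.2.1
  have e1 : -((q + 2) * Complex.log s + joukowskyRem u q (Complex.log s)) =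
      q * Complex.log (joukowsky u s) + Complex.log (joukowsky u s) + -Complex.log s +
        Complex.log (joukowskyFactor u q (Complex.log s)) := by
    rw [joukowskyRem, hL]
    ring
  have e2 : Complex.exp (2 * Complex.log s) / joukowskyNum u (Complex.log s) = s / joukowsky u s := by
    have : joukowskyNum u (Complex.log s) = s * joukowsky u s := by
      rw [joukowskyNum, two_mul, Complex.exp_add, Complex.exp_log hs0, joukowsky]
      field_simp
      ring
    rw [this, two_mul, Complex.exp_add, Complex.exp_log hs0]
    field_simp
  rw [e1, Complex.exp_add, Complex.exp_add, Complex.exp_add, Complex.exp_log hfac, Complex.exp_log hζ,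
    Complex.exp_neg, Complex.exp_log hs0, joukowskyFactor, ← hL, mul_div_assoc, e2, joukowskyCauchy,
    liftedCauchy, Complex.exp_log hζ]
  field_simp
  ring

set_option maxHeartbeats 800000 in
/-- Near `0` the map `joukowskyCauchy` is injective. -/
lemma exists_injOn_joukowskyCauchy (u : ℝ) {q : ℝ} (hq : 1 ≤ q) : ∃ ρ : ℝ, 0 < ρ ∧
    ∀ s ∈ joukowskyDomain u q, ∀ t ∈ joukowskyDomain u q, ‖s‖ < ρ → ‖t‖ < ρ →
      joukowskyCauchy u q s = joukowskyCauchy u q t → s = t := by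
  have hq0 : 0 < q := by linarith
  have hpi := Real.pi_pos
  have hpi3 := Real.pi_gt_three
  have hκ : 0 < Real.pi / q := by positivity
  set κ := Real.pi / q with hκd
  have hκ3 : κ ≤ Real.pi := div_le_self hpi.le hq
  have hκ4 := Real.pi_lt_d2
  set ε : ℝ := min (1 / (2 * (q + 2))) (κ / 4) with hε
  have hε0 : 0 < ε := by positivity
  have hε1 : (q + 2) * ε ≤ 1 / 2 := by
    calc (q + 2) * ε ≤ (q + 2) * (1 / (2 * (q + 2))) := by gcongr; exact min_le_left _ _
      _ = 1 / 2 := by field_simp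
  have hε2 : ε ≤ κ / 4 := min_le_right _ _
  have hε3 : ε < 1 / 2 := by nlinarith
  obtain ⟨A, hA⟩ := joukowskyRem_small u hq hε0
  set S : Set ℂ := {l | l.re < A - 1} ∩ {l | -(5 / 4 * κ) < l.im} ∩ {l | l.im < 5 / 4 * κ} with hS
  have hSc : Convex ℝ S := ((convex_halfSpace_re_lt _).inter (convex_halfSpace_im_gt _)).inter
    (convex_halfSpace_im_lt _)
  have hSA : ∀ l ∈ S, ∀ z ∈ Metric.closedBall l (κ / 4), z.re ≤ A ∧ |z.im| ≤ 3 / 2 * κ := by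
    rintro l ⟨⟨h1, h2⟩, h3⟩ z hz
    have hz' : ‖z - l‖ ≤ κ / 4 := by rwa [← dist_eq_norm]
    have e1 := abs_le.1 ((Complex.abs_re_le_norm _).trans hz')
    have e2 := abs_le.1 ((Complex.abs_im_le_norm _).trans hz')
    simp only [Complex.sub_re, Complex.sub_im, mem_ofPred_eq] at e1 e2 h1 h2 h3
    exact ⟨by linarith, abs_le.2 ⟨by linarith, by linarith⟩⟩
  have hSd : ∀ l ∈ S, ‖deriv (joukowskyRem u q) l‖ ≤ 1 := by
    intro l hl
    have h1 := Complex.norm_deriv_le_of_forall_mem_sphere_norm_le (f := joukowskyRem u q) (c := l)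
      (R := κ / 4) (C := ε) (by positivity) (by
        refine DifferentiableOn.diffContOnCl fun z hz => ?_
        rw [closure_ball _ (by positivity)] at hz
        have := hSA l hl z hz
        exact (hA z this.1 this.2).2.2.2.2.differentiableWithinAt)
      (fun z hz => by
        have := hSA l hl z (Metric.sphere_subset_closedBall hz)
        exact (hA z this.1 this.2).2.2.2.1.le)
    refine h1.trans ?_
    rw [div_le_one (by positivity)]
    exact hε2
  obtain ⟨r, hr0, hr⟩ : ∃ r : ℝ, 0 < r ∧ ∀ s : ℂ, s ≠ 0 → ‖s‖ < r →
      joukowskyNum u (Complex.log s) ≠ 0 ∧ ‖Complex.log (joukowskyNum u (Complex.log s))‖ < ε := by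
    have h1 : Tendsto (fun s : ℂ => 1 + (u * s + s * s)) (𝓝 0) (𝓝 1) := by
      have : Continuous fun s : ℂ => 1 + (u * s + s * s) := by fun_prop
      simpa using this.tendsto 0
    have h2 := h1.clog Complex.one_mem_slitPlane
    rw [Complex.log_one] at h2
    have h3 := (h1.eventually_ne one_ne_zero).and
      (h2.norm.eventually (gt_mem_nhds (show ‖(0 : ℂ)‖ < ε by simpa)))
    obtain ⟨r, hr0, hr⟩ := Metric.eventually_nhds_iff.1 h3
    refine ⟨r, hr0, fun s hs0 hs => ?_⟩
    have h4 := hr (show dist s 0 < r by rwa [dist_zero_right])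
    rwa [joukowskyNum, two_mul, Complex.exp_add, Complex.exp_log hs0]
  have hlog : ∀ s ∈ joukowskyDomain u q, ‖s‖ < min (min 1 (Real.exp (A - 1))) r →
      Complex.log s ∈ S ∧ (Complex.log s).im < 0 ∧
      -(Real.pi / (q + 1)) - ε < (Complex.log s).im ∧ -q * joukowskyCauchy u q s =
      Complex.exp (-((q + 2) * Complex.log s + joukowskyRem u q (Complex.log s))) ∧
      ‖joukowskyRem u q (Complex.log s)‖ < ε := by
    intro s hs hn
    have hs0 := ne_zero_of_im_neg hs.1
    have hn1 := hn.trans_le ((min_le_left _ _).trans (min_le_left _ _))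
    have hn2 := hn.trans_le ((min_le_left _ _).trans (min_le_right _ _))
    obtain ⟨hN, hNε⟩ := hr s hs0 (hn.trans_le (min_le_right _ _))
    have hre : (Complex.log s).re < A - 1 := by
      rw [Complex.log_re]
      exact (Real.log_lt_iff_lt_exp (norm_pos_iff.2 hs0)).2 hn2
    have him : (Complex.log s).im < 0 := by
      rw [Complex.log_im, Complex.arg_neg_iff]; exact hs.1
    have hL := congrArg Complex.im (log_joukowsky_eq hq hs hn1 hN (by linarith))
    rw [Complex.add_im, Complex.neg_im, Complex.log_im] at hL
    have h1 := abs_lt.1 ((Complex.abs_im_le_norm _).trans_lt hNε)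
    have h2 := hs.2.2.2
    have h3 := pi_div_add_one_lt hq
    have him' : -(Real.pi / (q + 1)) - ε < (Complex.log s).im := by linarith
    rw [← hκd] at h3
    have hlow : -(5 / 4 * κ) < (Complex.log s).im := by linarith
    have hupp : (Complex.log s).im < 5 / 4 * κ := by linarith
    have hmem : Complex.log s ∈ S := ⟨⟨hre, hlow⟩, hupp⟩
    have hAs := hSA _ hmem _ (Metric.mem_closedBall_self (by positivity))
    obtain ⟨-, -, e3, e4, -⟩ := hA _ hAs.1 hAs.2
    exact ⟨hmem, him, him', joukowskyCauchy_eq_exp hq hs hn1 hN (by linarith) e3, e4⟩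
  refine ⟨min (min 1 (Real.exp (A - 1))) r, by positivity, fun s hs t ht hsn htn hst => ?_⟩
  obtain ⟨hsS, s1, s2, s3, s4⟩ := hlog s hs hsn
  obtain ⟨htS, t1, t2, t3, t4⟩ := hlog t ht htn
  have hs0 := ne_zero_of_im_neg hs.1
  have ht0 := ne_zero_of_im_neg ht.1
  rw [hst, t3] at s3
  obtain ⟨n, hn⟩ := Complex.exp_eq_exp_iff_exists_int.1 s3
  have him := congrArg Complex.im hn
  have s5 := abs_lt.1 ((Complex.abs_im_le_norm _).trans_lt s4)
  have t5 := abs_lt.1 ((Complex.abs_im_le_norm _).trans_lt t4)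
  simp only [Complex.add_im, Complex.neg_im, Complex.mul_im, Complex.intCast_re,
    Complex.intCast_im, Complex.mul_re, Complex.ofReal_re, Complex.ofReal_im, Complex.I_re,
    Complex.I_im, Complex.re_ofNat, Complex.im_ofNat, Complex.add_re] at him
  have hq2 : (q + 2) * (Real.pi / (q + 1)) ≤ 3 / 2 * Real.pi := by
    rw [← mul_div_assoc, div_le_iff₀ (by linarith)]
    nlinarith
  have hsb : -(3 / 2 * Real.pi + 1 / 2) < (q + 2) * (Complex.log s).im := by nlinarith
  have htb : -(3 / 2 * Real.pi + 1 / 2) < (q + 2) * (Complex.log t).im := by nlinarith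
  have hsb' : (q + 2) * (Complex.log s).im < 0 := by nlinarith
  have htb' : (q + 2) * (Complex.log t).im < 0 := by nlinarith
  have hn0 : n = 0 := by
    have e1 : (-1 : ℝ) < n := by nlinarith
    have e2 : (n : ℝ) < 1 := by nlinarith
    have e1' : (-1 : ℤ) < n := by exact_mod_cast e1
    have e2' : n < 1 := by exact_mod_cast e2
    omega
  have hlip : ‖joukowskyRem u q (Complex.log t) - joukowskyRem u q (Complex.log s)‖ ≤
      1 * ‖Complex.log t - Complex.log s‖ := by
    refine hSc.norm_image_sub_le_of_norm_deriv_le (fun l hl => ?_) hSd hsS htS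
    have hAs := hSA _ hl _ (Metric.mem_closedBall_self (by positivity))
    exact (hA _ hAs.1 hAs.2).2.2.2.2
  have heq : ((q + 2 : ℝ) : ℂ) * (Complex.log t - Complex.log s) =
      -(joukowskyRem u q (Complex.log t) - joukowskyRem u q (Complex.log s)) := by
    rw [hn0] at hn
    push_cast
    linear_combination -hn
  have hnorm := congrArg norm heq
  rw [norm_neg, norm_mul, Complex.norm_real, Real.norm_of_nonneg (by linarith)] at hnorm
  have h0 : ‖Complex.log t - Complex.log s‖ = 0 := by
    have h1 := norm_nonneg (Complex.log t - Complex.log s)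
    have h2 := mul_nonneg hq0.le h1
    linarith
  rw [← Complex.exp_log hs0, ← Complex.exp_log ht0, sub_eq_zero.1 (norm_eq_zero.1 h0)]

lemma exists_norm_joukowskyCauchy_le {u q : ℝ} (hu : 2 ≤ u) (hq : 1 ≤ q) {ρ : ℝ} (hρ : 0 < ρ) :
    ∃ R : ℝ, ∀ s ∈ joukowskyDomain u q, ρ ≤ ‖s‖ → ‖joukowskyCauchy u q s‖ ≤ R := by
  have hq0 : 0 < q := by linarith
  obtain ⟨C, hC0, hC⟩ := exists_joukowskyCauchy_bounds u hq
  have ha : 0 < (u + 2) ^ (-q) := Real.rpow_pos_of_pos (by linarith) _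
  have h1 : ∀ᶠ X : ℝ in atTop, X ^ (-q) < (u + 2) ^ (-q) / 2 :=
    (tendsto_rpow_neg_atTop hq0).eventually (gt_mem_nhds (by positivity))
  obtain ⟨X, hX1, hX2⟩ := (h1.and (eventually_ge_atTop (u + 1 + ρ⁻¹))).exists
  have hρi : 0 < ρ⁻¹ := inv_pos.2 hρ
  have hX0 : 0 < X := by linarith
  refine ⟨max (X ^ q * (X / (q * ρ) + C)) (2 / (u + 2) ^ (-q)), fun s hs hsρ => ?_⟩
  have hζ := Complex.slitPlane_ne_zero hs.2.1
  rcases le_or_gt ‖joukowsky u s‖ X with h | h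
  · refine le_max_of_le_left (((hC s hs).1).trans ?_)
    gcongr
  · refine le_max_of_le_right ?_
    have h2 : ‖joukowsky u s‖ ≤ u + ‖s‖ + ρ⁻¹ := by
      rw [joukowsky]
      refine (norm_add₃_le).trans ?_
      rw [Complex.norm_real, Real.norm_of_nonneg (by linarith), norm_inv]
      gcongr
    rw [(joukowskyCauchy_eq_powCauchy hu hq hs (by linarith)).2]
    refine norm_powCauchy_le_of_small hu hq ?_
    rw [norm_exp_neg_mul_log q hζ]
    exact (Real.rpow_le_rpow_of_nonpos hX0 h.le (by linarith)).trans hX1.le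

/-- `joukowskyCauchy` has at most one preimage of each sufficiently large value. -/
lemma exists_joukowskyCauchy_inj_of_large {u q : ℝ} (hu : 2 ≤ u) (hq : 1 ≤ q) : ∃ R : ℝ,
    ∀ s ∈ joukowskyDomain u q, ∀ t ∈ joukowskyDomain u q, R < ‖joukowskyCauchy u q s‖ →
      joukowskyCauchy u q s = joukowskyCauchy u q t → s = t := by
  obtain ⟨ρ, hρ0, hρ⟩ := exists_injOn_joukowskyCauchy u hq
  obtain ⟨R, hR⟩ := exists_norm_joukowskyCauchy_le hu hq hρ0
  refine ⟨R, fun s hs t ht hsR hst => hρ s hs t ht ?_ ?_ hst⟩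
  · by_contra! h
    exact absurd (hR s hs h) hsR.not_ge
  · by_contra! h
    exact absurd (hR t ht h) (hst ▸ hsR).not_ge

/-- The part of `joukowskyDomain` that `joukowskyCauchy` maps to the lower half-plane. -/
def uniformDomain (u q : ℝ) : Set ℂ := {s | s ∈ joukowskyDomain u q ∧ (joukowskyCauchy u q s).im < 0}

lemma isOpen_uniformDomain (u : ℝ) {q : ℝ} (hq : 1 ≤ q) : IsOpen (uniformDomain u q) :=
  (differentiableOn_joukowskyCauchy u hq).continuousOn.isOpen_inter_preimage
    (isOpen_joukowskyDomain u q) (isOpen_lt Complex.continuous_im continuous_const)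

lemma exists_cone {w : ℂ} (hw : w.im < 0) : ∃ γ : ℝ, 0 < γ ∧ γ * |w.re| < -w.im := by
  refine ⟨-w.im / (|w.re| + 1), by have := abs_nonneg w.re; apply div_pos <;> linarith, ?_⟩
  have := abs_nonneg w.re
  rw [div_mul_eq_mul_div, div_lt_iff₀ (by linarith)]
  nlinarith

lemma im_liftedCauchy_ofReal {u q : ℝ} (hu : 2 ≤ u) (hq : 1 ≤ q) (x l : ℝ) :
    (liftedCauchy u q x l).im = 0 := by
  obtain ⟨y, -, hy⟩ := semicircleKernel_real hu hq l
  rw [liftedCauchy, hy]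
  norm_cast

lemma tendsto_joukowskyCauchy_zero (u : ℝ) {q : ℝ} (hq : 1 ≤ q) {𝒰 : Ultrafilter ℂ}
    (hD : joukowskyDomain u q ∈ 𝒰) {s : ℂ} (hs0 : s ≠ 0) (hs : joukowsky u s = 0)
    (h𝒰 : (𝒰 : Filter ℂ) ≤ 𝓝 s) : Tendsto (joukowskyCauchy u q) 𝒰 (𝓝 0) := by
  have hq0 : 0 < q := by linarith
  obtain ⟨C, hC0, hC⟩ := exists_joukowskyCauchy_bounds u hq
  have h1 : Tendsto (fun t => ‖joukowsky u t‖) 𝒰 (𝓝 0) := by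
    have := ((continuousAt_joukowsky u hs0).tendsto.mono_left h𝒰).norm
    rwa [hs, norm_zero] at this
  have h2 : Tendsto (fun t : ℂ => ‖t‖) 𝒰 (𝓝 ‖s‖) := (continuous_norm.tendsto s).mono_left h𝒰
  have h3 : Tendsto (fun t => ‖joukowsky u t‖ ^ q * (‖joukowsky u t‖ / (q * ‖t‖) + C)) 𝒰 (𝓝 0) := by
    have h4 := h1.rpow_const (p := q) (Or.inr hq0.le)
    rw [Real.zero_rpow hq0.ne'] at h4
    have h5 := h4.mul ((h1.div (h2.const_mul q)
      (mul_ne_zero hq0.ne' (norm_ne_zero_iff.2 hs0))).add_const C)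
    rwa [zero_mul] at h5
  exact squeeze_zero_norm' (by filter_upwards [hD] with t ht using (hC t ht).1) h3

lemma bijOn_joukowskyCauchy {u q : ℝ} (hu : 2 ≤ u) (hq : 1 ≤ q) :
    BijOn (joukowskyCauchy u q) (uniformDomain u q) {w | w.im < 0} ∧
      ∀ s ∈ uniformDomain u q, deriv (joukowskyCauchy u q) s ≠ 0 := by
  obtain ⟨R, hR⟩ := exists_joukowskyCauchy_inj_of_large hu hq
  have hsub : uniformDomain u q ⊆ joukowskyDomain u q := fun s hs => hs.1
  refine bijOn_of_proper_of_injOn_fiber (W := {w : ℂ | w.im < 0} ∩ {w | R < ‖w‖})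
    (isOpen_uniformDomain u hq) (convex_halfSpace_im_lt 0).isPreconnected
    ((differentiableOn_joukowskyCauchy u hq).mono hsub) (fun s hs => hs.2) ?_ ?_
    ((isOpen_lt Complex.continuous_im continuous_const).inter
      (isOpen_lt continuous_const continuous_norm)) ?_ inter_subset_left
    (fun s hs t ht hW h => hR s hs.1 t ht.1 hW.2 h)
  · obtain ⟨s, hs, hs1, -⟩ := exists_joukowsky_path hu hq one_pos
    refine ⟨s, hs, ?_⟩
    rw [hs1]
    exact im_powCauchy_neg u q (by simp)
  · intro 𝒰 h𝒰 w hw hlim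
    obtain ⟨γ, hγ, hγw⟩ := exists_cone hw
    have hopen : IsOpen {w : ℂ | γ * |w.re| < -w.im} :=
      isOpen_lt (continuous_const.mul (continuous_abs.comp Complex.continuous_re))
        Complex.continuous_im.neg
    have hD : joukowskyDomain u q ∈ 𝒰 := mem_of_superset h𝒰 hsub
    rcases joukowskyCauchy_limit_cases hu hq hγ 𝒰 hD (hlim (hopen.mem_nhds hγw)) hlim with
      ⟨s, hs, hle⟩ | ⟨s, hs0, hs, hle⟩ | ⟨x, -, -, hx⟩
    · have hc := ((differentiableOn_joukowskyCauchy u hq).differentiableAt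
        ((isOpen_joukowskyDomain u q).mem_nhds hs)).continuousAt
      have := tendsto_nhds_unique (hc.tendsto.mono_left hle) hlim
      exact ⟨s, ⟨hs, this ▸ hw⟩, hle⟩
    · have := tendsto_nhds_unique (tendsto_joukowskyCauchy_zero u hq hD hs0 hs hle) hlim
      rw [← this] at hw
      simp at hw
    · rw [hx] at hw
      exact absurd (im_liftedCauchy_ofReal hu hq x _) hw.ne
  · refine ⟨-(|R| + 1) * Complex.I, ?_, ?_⟩
    · have := abs_nonneg R
      simp
      linarith
    · have h1 := le_abs_self R
      have h2 := abs_nonneg R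
      have : ‖-((|R| : ℝ) + 1 : ℂ) * Complex.I‖ = |R| + 1 := by
        rw [norm_mul, norm_neg, Complex.norm_I, mul_one, ← Complex.ofReal_one, ← Complex.ofReal_add,
          Complex.norm_real, Real.norm_of_nonneg (by linarith)]
      show R < _
      rw [this]
      linarith

lemma BijOn.exists_differentiableOn_inverse {U V : Set ℂ} {f : ℂ → ℂ} (hU : IsOpen U)
    (hf : DifferentiableOn ℂ f U) (hbij : BijOn f U V) (hd : ∀ z ∈ U, deriv f z ≠ 0) :
    ∃ g : ℂ → ℂ, (∀ w ∈ V, g w ∈ U ∧ f (g w) = w) ∧ DifferentiableOn ℂ g V := by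
  have hsurj : ∀ w ∈ V, ∃ z, z ∈ U ∧ f z = w := fun w hw => hbij.surjOn hw
  choose! g hgU hfg using hsurj
  refine ⟨g, fun w hw => ⟨hgU w hw, hfg w hw⟩, fun w hw => ?_⟩
  have hg := hgU w hw
  have hfw := hfg w hw
  have hs : HasStrictDerivAt f (deriv f (g w)) (g w) :=
    ((hf.analyticAt (hU.mem_nhds hg)).contDiffAt (n := 1)).hasStrictDerivAt (by simp)
  have hmap := hs.map_nhds_eq (hd _ hg)
  rw [hfw] at hmap
  have hV : V ∈ 𝓝 w := by
    rw [← hmap, mem_map]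
    exact mem_of_superset (hU.mem_nhds hg) hbij.mapsTo
  have hc : ContinuousAt g w := by
    intro N hN
    have h1 : f '' (N ∩ U) ∈ 𝓝 w := by
      rw [← hmap]
      exact image_mem_map (inter_mem hN (hU.mem_nhds hg))
    change g ⁻¹' N ∈ 𝓝 w
    refine mem_of_superset h1 ?_
    rintro _ ⟨z, ⟨hzN, hzU⟩, rfl⟩
    have hV' := hbij.mapsTo hzU
    have : g (f z) = z := hbij.injOn (hgU _ hV') hzU (hfg _ hV')
    rw [mem_preimage, this]
    exact hzN
  exact (HasDerivAt.of_local_left_inverse hc hs.hasDerivAt (hd _ hg)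
    (by filter_upwards [hV] with y hy using hfg y hy)).differentiableAt.differentiableWithinAt

lemma tendsto_powCauchy_mul_I (u q : ℝ) :
    Tendsto (fun y : ℝ => powCauchy u q (y * Complex.I)) atTop (𝓝 0) := by
  refine squeeze_zero_norm' ?_ tendsto_inv_atTop_zero
  filter_upwards [eventually_gt_atTop 0] with y hy
  have := norm_powCauchy_le u q (z := y * Complex.I) (by simpa using hy.ne')
  simpa [abs_of_pos hy] using this

lemma joukowskyCauchy_ne_zero {u q : ℝ} (hu : 2 ≤ u) (hq : 1 ≤ q) {s : ℂ}
    (hs : s ∈ joukowskyDomain u q) (hnc : ¬ ∀ᶠ t in 𝓝 s, joukowskyCauchy u q t = joukowskyCauchy u q s) :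
    joukowskyCauchy u q s ≠ 0 := by
  intro h0
  have hq0 : 0 < q := by linarith
  have hDn := (isOpen_joukowskyDomain u q).mem_nhds hs
  have han := (differentiableOn_joukowskyCauchy u hq).analyticAt hDn
  have hle := han.eventually_constant_or_nhds_le_map_nhds.resolve_left hnc
  have hζ : 0 < ‖joukowsky u s‖ := norm_pos_iff.2 (Complex.slitPlane_ne_zero hs.2.1)
  have hN : ∀ᶠ t in 𝓝 s, ‖joukowsky u s‖ / 2 < ‖joukowsky u t‖ :=
    (continuousAt_joukowsky u (ne_zero_of_im_neg hs.1)).norm.tendsto.eventually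
      (lt_mem_nhds (half_lt_self hζ))
  have himg := hle (image_mem_map (inter_mem hDn hN))
  rw [h0] at himg
  have hexp : Tendsto (fun y : ℝ => Real.exp (-Real.log y / q)) atTop (𝓝 0) :=
    Real.tendsto_exp_atBot.comp
      ((tendsto_neg_atTop_atBot.comp Real.tendsto_log_atTop).atBot_div_const hq0)
  obtain ⟨y, hy, ⟨t, ⟨ht, htN⟩, hty⟩, hye⟩ := ((eventually_gt_atTop (0 : ℝ)).and
    (((tendsto_powCauchy_mul_I u q).eventually himg).and (hexp.eventually (gt_mem_nhds (half_pos hζ))))).exists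
  obtain ⟨p, hp, hpy, hpn⟩ := exists_joukowsky_path hu hq hy
  have him : (powCauchy u q (y * Complex.I)).im < 0 := im_powCauchy_neg u q (by simpa using hy)
  have hpt : p = t := (bijOn_joukowskyCauchy hu hq).1.injOn ⟨hp, by rwa [hpy]⟩ ⟨ht, by rwa [hty]⟩
    (hpy.trans hty.symm)
  rw [hpt] at hpn
  have htN' : ‖joukowsky u s‖ / 2 < ‖joukowsky u t‖ := htN
  linarith

lemma not_cone_of_norm_sub_le {v w : ℂ} (hv : v ≠ 0) (hvi : 0 ≤ v.im) (h : ‖w - v‖ ≤ ‖v‖ / 4) :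
    -w.im ≤ |w.re| := by
  by_contra! hc
  have h1 := abs_le.1 ((Complex.abs_re_le_norm _).trans h)
  have h2 := abs_le.1 ((Complex.abs_im_le_norm _).trans h)
  rw [Complex.sub_re] at h1
  rw [Complex.sub_im] at h2
  have h3 := Complex.norm_le_abs_re_add_abs_im v
  have h4 := norm_pos_iff.2 hv
  rw [abs_of_nonneg hvi] at h3
  obtain ⟨h5, h6⟩ := abs_lt.1 hc
  rcases abs_cases v.re with h7 | h7 <;> linarith [abs_nonneg w.re]

lemma not_cone_of_tendsto_zero (u : ℝ) {q : ℝ} (hq : 1 ≤ q) {l : Filter ℂ} [NeBot l]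
    {s : ℂ} (hs0 : s ≠ 0) (hs : joukowsky u s = 0) (hl : l ≤ 𝓝 s)
    (h : ∀ᶠ t in l, t ∈ joukowskyDomain u q ∧ ‖t‖ ≤ 1 ∧
      |(joukowskyCauchy u q t).re| < -(joukowskyCauchy u q t).im) : False := by
  have hq0 : 0 < q := by linarith
  have hpi := Real.pi_pos
  have hκ : 0 < Real.pi / q := by positivity
  have h1 : Tendsto (joukowsky u) l (𝓝 0) := hs ▸ (continuousAt_joukowsky u hs0).tendsto.mono_left hl
  have h2 : Tendsto (fun t => Complex.log (joukowsky u t)) l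
      (comap Complex.re atBot ⊓ 𝓟 {L | |L.im| ≤ 7 / 4 * (Real.pi / q)}) := by
    refine tendsto_inf.2 ⟨tendsto_comap_iff.2 ?_, tendsto_principal.2 ?_⟩
    · have h3 : Tendsto (fun t => ‖joukowsky u t‖) l (𝓝[>] 0) := by
        refine tendsto_nhdsWithin_iff.2 ⟨by simpa using h1.norm, ?_⟩
        filter_upwards [h] with t ht
        exact norm_pos_iff.2 (Complex.slitPlane_ne_zero ht.1.2.1)
      exact (Real.tendsto_log_nhdsGT_zero.comp h3).congr fun t => by simp [Complex.log_re]
    · filter_upwards [h] with t ht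
      have := abs_arg_joukowsky_lt hq ht.1
      show |_| ≤ _
      linarith
  have h3 : Tendsto (fun t => -(q : ℂ)⁻¹ * (joukowsky u t / t) +
      semicircleKernel u q (Complex.log (joukowsky u t))) l (𝓝 1) := by
    have h4 : Tendsto (fun t : ℂ => t) l (𝓝 s) := hl
    have h5 := (((h1.div h4 hs0).const_mul (-(q : ℂ)⁻¹))).add ((tendsto_semicircleKernel u hq).comp h2)
    rwa [zero_div, mul_zero, zero_add] at h5
  obtain ⟨t, ⟨htD, ht1, htc⟩, htE⟩ := (h.and (h3.eventually
    (Metric.closedBall_mem_nhds 1 (by norm_num : (0 : ℝ) < 1 / 4)))).exists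
  have hζ := Complex.slitPlane_ne_zero htD.2.1
  rw [dist_eq_norm] at htE
  have hLim : 0 ≤ (Complex.log (joukowsky u t)).im := by
    rw [Complex.log_im, Complex.arg_nonneg_iff]
    by_contra! h4
    exact ((im_joukowsky_neg_iff u htD.1).1 h4).not_ge ht1
  have hLim' := (abs_lt.1 (abs_arg_joukowsky_lt hq htD)).2
  refine absurd htc (not_cone_of_norm_sub_le (v := Complex.exp (q * Complex.log (joukowsky u t)))
    (Complex.exp_ne_zero _) ?_ ?_).not_gt
  · rw [Complex.exp_im, Complex.im_ofReal_mul]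
    refine mul_nonneg (Real.exp_pos _).le (Real.sin_nonneg_of_nonneg_of_le_pi (by positivity) ?_)
    rw [lt_div_iff₀ hq0] at hLim'
    linarith
  · rw [joukowskyCauchy, liftedCauchy, Complex.exp_log hζ, ← mul_sub_one, norm_mul]
    exact (mul_le_mul_of_nonneg_left htE (norm_nonneg _)).trans_eq (by ring)

lemma re_liftedCauchy_neg_of_one_lt {u q : ℝ} (hu : 2 ≤ u) (hq : 1 ≤ q) : ∃ c : ℝ, 0 < c ∧
    ∀ x : ℝ, 1 < x → (liftedCauchy u q x (Real.log (u + x + x⁻¹))).re ≤ -c := by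
  have hq0 : 0 < q := by linarith
  obtain ⟨c, hc0, hc⟩ := exists_re_powCauchy_le hu hq
  refine ⟨c, hc0, fun x hx => ?_⟩
  have hx0 : 0 < x := by linarith
  have h2 : u + 2 < u + x + x⁻¹ := by
    have : 0 < x + x⁻¹ - 2 := by
      have : x + x⁻¹ - 2 = (x - 1) ^ 2 / x := by field_simp; ring
      rw [this]
      have : 0 < x - 1 := by linarith
      positivity
    linarith
  have hpos : 0 < u + x + x⁻¹ := by linarith
  rw [liftedCauchy_eq_powCauchy hu hq (by rwa [Complex.norm_real, Real.norm_of_nonneg hx0.le])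
    (by rw [← Complex.ofReal_exp, Real.exp_log hpos, joukowsky]; push_cast; rfl)
    (by rw [Complex.ofReal_im, abs_zero]; have := Real.pi_pos; positivity)]
  have : Complex.exp (-(q * (Real.log (u + x + x⁻¹) : ℂ))) = ((u + x + x⁻¹) ^ (-q) : ℝ) := by
    rw [Real.rpow_def_of_pos hpos]
    push_cast
    congr 1
    ring
  rw [this]
  exact hc _ (Real.rpow_pos_of_pos hpos _) (Real.rpow_lt_rpow_of_neg (by linarith) h2 (by linarith))

lemma liftedCauchy_ofReal_ne_zero {u q : ℝ} (hu : 2 ≤ u) (hq : 1 ≤ q) {x : ℝ} (hx : x ≠ 0)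
    (hpos : 0 < u + x + x⁻¹) : liftedCauchy u q x (Real.log (u + x + x⁻¹)) ≠ 0 := by
  have hq0 : 0 < q := by linarith
  obtain ⟨c, hc0, hc⟩ := re_liftedCauchy_neg_of_one_lt hu hq
  have hge : ∀ x : ℝ, 1 ≤ x → (liftedCauchy u q x (Real.log (u + x + x⁻¹))).re ≤ -c := by
    intro x hx
    rcases hx.lt_or_eq with h | rfl
    · exact hc x h
    · have h1 : Tendsto (fun x : ℝ => (x : ℂ)) (𝓝[>] 1) (𝓝 ((1 : ℝ) : ℂ)) :=
        (Complex.continuous_ofReal.tendsto 1).mono_left nhdsWithin_le_nhds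
      have h2 : Tendsto (fun x : ℝ => ((Real.log (u + x + x⁻¹) : ℝ) : ℂ)) (𝓝[>] 1)
          (𝓝 ((Real.log (u + 1 + 1⁻¹) : ℝ) : ℂ)) := by
        have : ContinuousAt (fun x : ℝ => Real.log (u + x + x⁻¹)) 1 := by
          refine ContinuousAt.log ?_ (by norm_num; linarith)
          exact (continuousAt_const.add continuousAt_id).add (continuousAt_inv₀ one_ne_zero)
        exact ((Complex.continuous_ofReal.tendsto _).comp this.tendsto).mono_left nhdsWithin_le_nhds
      have h3 := tendsto_liftedCauchy (u := u) hq (by simp)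
        (by rw [Complex.ofReal_im, abs_zero]; have := Real.pi_pos; positivity) h1 h2
      refine le_of_tendsto ((Complex.continuous_re.tendsto _).comp h3) ?_
      filter_upwards [self_mem_nhdsWithin] with x hx using hc x hx
  rcases lt_or_gt_of_ne hx with h | h
  · obtain ⟨y, hy0, hy⟩ := semicircleKernel_real hu hq (Real.log (u + x + x⁻¹))
    rw [liftedCauchy, hy, ← Complex.ofReal_exp, Real.exp_log hpos]
    refine mul_ne_zero (Complex.exp_ne_zero _) ?_
    have : 0 < -q⁻¹ * ((u + x + x⁻¹) / x) + y := by
      have h1 : (u + x + x⁻¹) / x < 0 := div_neg_of_pos_of_neg hpos h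
      have h2 : 0 < q⁻¹ := inv_pos.2 hq0
      nlinarith
    exact_mod_cast this.ne'
  · intro h0
    rcases le_or_gt 1 x with h1 | h1
    · have := hge x h1
      rw [h0, Complex.zero_re] at this
      linarith
    · have h2 := hge x⁻¹ ((one_le_inv₀ h).2 h1.le)
      rw [inv_inv, add_right_comm] at h2
      rw [liftedCauchy_inv, ← Complex.ofReal_inv] at h0
      have h3 : (q : ℂ)⁻¹ * Complex.exp ((q + 1) * (Real.log (u + x + x⁻¹) : ℝ)) * ((x⁻¹ : ℝ) - x) =
          ((q⁻¹ * Real.exp ((q + 1) * Real.log (u + x + x⁻¹)) * (x⁻¹ - x) : ℝ) : ℂ) := by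
        push_cast; rfl
      rw [sub_eq_zero.1 h0, h3, Complex.ofReal_re] at h2
      have h4 : 0 < x⁻¹ - x := by
        have := (one_lt_inv₀ h).2 h1
        linarith
      have : 0 < q⁻¹ * Real.exp ((q + 1) * Real.log (u + x + x⁻¹)) * (x⁻¹ - x) := by positivity
      linarith

lemma exists_one_lt_norm_of_cone {u q : ℝ} (hu : 2 ≤ u) (hq : 1 ≤ q) : ∃ r : ℝ, 0 < r ∧
    ∀ s ∈ uniformDomain u q, |(joukowskyCauchy u q s).re| < -(joukowskyCauchy u q s).im →
      ‖joukowskyCauchy u q s‖ < r → 1 < ‖s‖ := by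
  set B : Set ℂ := {s | s ∈ uniformDomain u q ∧
    |(joukowskyCauchy u q s).re| < -(joukowskyCauchy u q s).im ∧ ‖s‖ ≤ 1} with hB
  suffices h : comap (joukowskyCauchy u q) (𝓝 0) ⊓ 𝓟 B = ⊥ by
    have h1 : ∀ᶠ s in comap (joukowskyCauchy u q) (𝓝 0), s ∉ B := by
      rw [inf_principal_eq_bot] at h
      exact h
    rw [eventually_comap, Metric.eventually_nhds_iff] at h1
    obtain ⟨r, hr, h1⟩ := h1
    refine ⟨r, hr, fun s hs hc hn => ?_⟩
    by_contra! hle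
    exact h1 (by rwa [dist_zero_right]) s rfl ⟨hs, hc, hle⟩
  by_contra hbot
  have : NeBot (comap (joukowskyCauchy u q) (𝓝 0) ⊓ 𝓟 B) := ⟨hbot⟩
  set 𝒰 := Ultrafilter.of (comap (joukowskyCauchy u q) (𝓝 0) ⊓ 𝓟 B) with h𝒰
  have hle : (𝒰 : Filter ℂ) ≤ _ := Ultrafilter.of_le _
  have hlim : Tendsto (joukowskyCauchy u q) 𝒰 (𝓝 0) := tendsto_comap.mono_left (hle.trans inf_le_left)
  have hBmem : ∀ᶠ s in (𝒰 : Filter ℂ), s ∈ B := hle (mem_inf_of_right (mem_principal_self B))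
  have hD : ∀ᶠ s in (𝒰 : Filter ℂ), s ∈ joukowskyDomain u q := hBmem.mono fun s hs => hs.1.1
  have hcone : ∀ᶠ s in (𝒰 : Filter ℂ),
      1 * |(joukowskyCauchy u q s).re| < -(joukowskyCauchy u q s).im :=
    hBmem.mono fun s hs => by rw [one_mul]; exact hs.2.1
  rcases joukowskyCauchy_limit_cases hu hq one_pos 𝒰 hD hcone hlim with
    ⟨s, hs, hsle⟩ | ⟨s, hs0, hs, hsle⟩ | ⟨x, hx, hpos, hx0⟩
  · have hc := ((differentiableOn_joukowskyCauchy u hq).differentiableAt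
      ((isOpen_joukowskyDomain u q).mem_nhds hs)).continuousAt
    have h0 := tendsto_nhds_unique (hc.tendsto.mono_left hsle) hlim
    refine joukowskyCauchy_ne_zero hu hq hs (fun hconst => ?_) h0
    obtain ⟨t, ht1, ht2⟩ := ((hconst.filter_mono hsle).and hBmem).exists
    have ht3 := ht2.1.2
    have ht4 : joukowskyCauchy u q t = joukowskyCauchy u q s := ht1
    rw [ht4, h0] at ht3
    simp at ht3
  · exact not_cone_of_tendsto_zero u hq hs0 hs hsle (hBmem.mono fun t ht => ⟨ht.1.1, ht.2.2, ht.2.1⟩)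
  · exact liftedCauchy_ofReal_ne_zero hu hq hx hpos hx0.symm

lemma injOn_exp_log_joukowsky (u : ℝ) {q : ℝ} (hq : 1 ≤ q) :
    InjOn (fun s => Complex.exp (-(q * Complex.log (joukowsky u s)))) (joukowskyDomain u q) := by
  intro s hs t ht hst
  have hq0 : 0 < q := by linarith
  have hpi := Real.pi_pos
  have hbd : ∀ s ∈ joukowskyDomain u q, |q * (joukowsky u s).arg| < Real.pi := by
    intro s hs
    have := abs_arg_joukowsky_lt hq hs
    rw [Complex.log_im, lt_div_iff₀ hq0] at this
    rw [abs_mul, abs_of_pos hq0]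
    linarith
  have h1 := abs_lt.1 (hbd s hs)
  have h2 := abs_lt.1 (hbd t ht)
  obtain ⟨n, hn⟩ := Complex.exp_eq_exp_iff_exists_int.1 hst
  have him := congrArg Complex.im hn
  simp only [Complex.add_im, Complex.neg_im, Complex.log_im, Complex.mul_im,
    Complex.intCast_re, Complex.intCast_im, Complex.mul_re, Complex.ofReal_re, Complex.ofReal_im,
    Complex.I_re, Complex.I_im, Complex.re_ofNat, Complex.im_ofNat] at him
  have hn0 : n = 0 := by
    have e1 : (-1 : ℝ) < n := by nlinarith
    have e2 : (n : ℝ) < 1 := by nlinarith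
    have e1' : (-1 : ℤ) < n := by exact_mod_cast e1
    have e2' : n < 1 := by exact_mod_cast e2
    omega
  rw [hn0, Int.cast_zero, zero_mul, add_zero, neg_inj] at hn
  have hlog := mul_left_cancel₀ (by exact_mod_cast hq0.ne' : (q : ℂ) ≠ 0) hn
  have hζ := congrArg Complex.exp hlog
  rw [Complex.exp_log (Complex.slitPlane_ne_zero hs.2.1),
    Complex.exp_log (Complex.slitPlane_ne_zero ht.2.1)] at hζ
  exact joukowsky_inj u hs.1 ht.1 hζ

/-- If `S ~ S(0,1)` and `u ≥ 2`, then `(S+u)^r ∈ UI` for every `r ≤ -1`.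
The law of `S + u` is the semicircle distribution `S(u,1)`. -/
theorem semicircle_shift_power_UI (u : ℝ) (hu : 2 ≤ u) (r : ℝ) (hr : r ≤ -1) :
    IsUI (Measure.map (fun x : ℝ => x ^ r) (semicircle u)) := by
  have hq : 1 ≤ -r := by linarith
  have hU := isOpen_uniformDomain u hq
  obtain ⟨hbij, hd⟩ := bijOn_joukowskyCauchy hu hq
  have hH : DifferentiableOn ℂ (joukowskyCauchy u (-r)) (uniformDomain u (-r)) :=
    (differentiableOn_joukowskyCauchy u hq).mono fun s hs => hs.1
  obtain ⟨g, hg, hgd⟩ := BijOn.exists_differentiableOn_inverse hU hH hbij hd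
  obtain ⟨δ, hδ, hδs⟩ := exists_one_lt_norm_of_cone hu hq
  refine ⟨fun w => Complex.exp (-((-r : ℝ) * Complex.log (joukowsky u (g w)))), ?_, ?_, 1, one_pos,
    δ / 2, half_pos hδ, ?_⟩
  · refine DifferentiableOn.analyticOnNhd (fun w hw => ?_)
      (isOpen_lt Complex.continuous_im continuous_const)
    have hgw := (hg w hw).1.1
    have h1 : DifferentiableWithinAt ℂ (fun w => joukowsky u (g w)) {w | w.im < 0} w :=
      (((differentiableWithinAt_const _).add (hgd w hw)).add
        ((hgd w hw).inv (ne_zero_of_im_neg hgw.1)))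
    exact (((h1.clog hgw.2.1).const_mul _).neg).cexp
  · intro w hw w' hw' h
    have := injOn_exp_log_joukowsky u hq (hg w hw).1.1 (hg w' hw').1.1 h
    rw [← (hg w hw).2, ← (hg w' hw').2, this]
  · intro w hcone hwδ
    have hw : w.im < 0 := by have := abs_nonneg w.re; linarith
    obtain ⟨hgU, hgw⟩ := hg w hw
    have h1 : 1 < ‖g w‖ := by
      refine hδs _ hgU ?_ ?_
      · rw [hgw]; linarith
      · rw [hgw]
        refine (Complex.norm_le_abs_re_add_abs_im w).trans_lt ?_
        rw [abs_of_neg hw]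
        linarith
    obtain ⟨e1, e2⟩ := joukowskyCauchy_eq_powCauchy hu hq hgU.1 h1
    refine ⟨e1, ?_⟩
    rw [cauchyTransform_map_rpow, ← e2, hgw]
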